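/- Let S be a domain that is either a complete local Noetherian ring, or finitely generated as an algebra over a field or over ℤ, or, more generally, finitely generated over a Noetherian integrally closed domain R with the property that every finitely generated R-algebra has module-finite integral closure. Let 𝔞_• be a filtration of nonzero ideals in S and let 𝔟_• be a graded family that is 𝔟-equivalent for some ideal 𝔟 ⊆ S. Then ρ̂(𝔞_•, 𝔟̄_•) = ρ^{lim}(𝔞_•, 𝔟̄_•) = ρ̂(𝔞_•, 𝔟_•) = ρ^{lim}(𝔞_•, 𝔟_•). -/

import Mathlib

open Filter Polynomial
open scoped ENNReal NNReal

set_option synthInstance.maxHeartbeats 1000000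
set_option maxHeartbeats 1000000

universe u

section Preamble

variable {S : Type u} [CommRing S]

/-- A graded family of ideals: `a 0 = S` and `a p * a q ⊆ a (p + q)` for all `p, q`. -/
def GradedFamily (a : ℕ → Ideal S) : Prop :=
  a 0 = ⊤ ∧ ∀ p q : ℕ, a p * a q ≤ a (p + q)

/-- A filtration of ideals: a graded family which is descending. -/
def IdealFiltration (a : ℕ → Ideal S) : Prop :=
  GradedFamily a ∧ ∀ p : ℕ, a (p + 1) ≤ a p

/-- The integral closure of an ideal `I`: the ideal of all elements `x` satisfying an
equation of integral dependence `x ^ n + c 1 * x ^ (n - 1) + ⋯ + c n = 0` with `c i ∈ I ^ i`. -/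
noncomputable def intClosure (I : Ideal S) : Ideal S :=
  Ideal.span {x : S | ∃ n : ℕ, 0 < n ∧ ∃ c : ℕ → S,
    (∀ i, 1 ≤ i → i ≤ n → c i ∈ I ^ i) ∧
    x ^ n + ∑ i ∈ Finset.Icc 1 n, c i * x ^ (n - i) = 0}

/-- The resurgence `ρ(a, b) = sup { s / r : ¬ a s ⊆ b r }` (as an extended real number,
with `sSup ∅ = ⊥`). -/
noncomputable def resurgence (a b : ℕ → Ideal S) : EReal :=
  sSup {x : EReal | ∃ s r : ℕ, 0 < s ∧ 0 < r ∧ ¬ a s ≤ b r ∧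
    x = (((s : ℝ) / (r : ℝ) : ℝ) : EReal)}

/-- The asymptotic resurgence `ρ̂(a, b) = sup { s / r : ¬ a (s*t) ⊆ b (r*t) for all t ≫ 1}`. -/
noncomputable def asympResurgence (a b : ℕ → Ideal S) : EReal :=
  sSup {x : EReal | ∃ s r : ℕ, 0 < s ∧ 0 < r ∧
    (∀ᶠ t : ℕ in atTop, ¬ a (s * t) ≤ b (r * t)) ∧
    x = (((s : ℝ) / (r : ℝ) : ℝ) : EReal)}

/-- The `k`-th Veronese subalgebra of the Rees algebra of the graded family `b` is a
standard graded `S`-algebra, i.e. `b (k*n) = (b k) ^ n` for all `n ≥ 1`. -/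
def StdVeronese (b : ℕ → Ideal S) (k : ℕ) : Prop :=
  ∀ n : ℕ, 1 ≤ n → b (k * n) = b k ^ n

/-- The Rees algebra `ℛ(b) = ⊕ₙ bₙ tⁿ ⊆ S[t]` of a graded family, as a set of polynomials. -/
def ReesSet (b : ℕ → Ideal S) : Set (Polynomial S) :=
  {p : Polynomial S | ∀ n : ℕ, p.coeff n ∈ b n}

/-- `ℛ(b')` is a finitely generated `ℛ(b)`-module: there is a finite set `G ⊆ ℛ(b')`
such that every element of `ℛ(b')` is an `ℛ(b)`-linear combination of elements of `G`. -/
def ReesFGModule (b b' : ℕ → Ideal S) : Prop :=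
  ∃ G : Finset (Polynomial S), (G : Set (Polynomial S)) ⊆ ReesSet b' ∧
    ∀ p ∈ ReesSet b', ∃ c : Polynomial S → Polynomial S,
      (∀ g ∈ G, c g ∈ ReesSet b) ∧ p = ∑ g ∈ G, c g * g

/-- A graded family `b` is `bb`-equivalent (for an ideal `bb`) if for some `k`,
`b (i + k) ⊆ bb ^ i ⊆ b i` for all `i ≥ 1`. -/
def BEquivalent (bb : Ideal S) (b : ℕ → Ideal S) : Prop :=
  ∃ k : ℕ, ∀ i : ℕ, 1 ≤ i → b (i + k) ≤ bb ^ i ∧ bb ^ i ≤ b i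

/-- `β_n(a, b) = inf { d ≥ 1 : ¬ a n ⊆ b d }`, with `inf ∅ = ∞`. -/
noncomputable def betaIdx (a b : ℕ → Ideal S) (n : ℕ) : ℕ∞ :=
  sInf {d : ℕ∞ | ∃ m : ℕ, 0 < m ∧ ¬ a n ≤ b m ∧ d = (m : ℕ∞)}

/-- `ρ^n(a, b) = sup { s / β_s(a, b) : s ≥ n, β_s(a, b) < ∞ }`. -/
noncomputable def rhoN (a b : ℕ → Ideal S) (n : ℕ) : EReal :=
  sSup {x : EReal | ∃ s d : ℕ, n ≤ s ∧ 0 < s ∧ betaIdx a b s = (d : ℕ∞) ∧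
    x = (((s : ℝ) / (d : ℝ) : ℝ) : EReal)}

/-- `ρ^lim(a, b) = lim_{n → ∞} ρ^n(a, b)`, the limit of the nonincreasing sequence `ρ^n`,
i.e. its infimum. -/
noncomputable def rhoLim (a b : ℕ → Ideal S) : EReal :=
  ⨅ n : ℕ, rhoN a b n

end Preamble

section Valuations

variable {S : Type u} [CommRing S] [IsDomain S]

/-- A (discrete) valuation of the quotient field `K` of `S`: a function `v : K → ℤ` with
`v (x * y) = v x + v y` and `v (x + y) ≥ min (v x) (v y)` (for nonzero elements). -/
structure ValuationOn (S : Type u) [CommRing S] [IsDomain S] where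
  v : FractionRing S → ℤ
  map_mul : ∀ x y : FractionRing S, x ≠ 0 → y ≠ 0 → v (x * y) = v x + v y
  min_le_map_add : ∀ x y : FractionRing S, x ≠ 0 → y ≠ 0 → x + y ≠ 0 →
    min (v x) (v y) ≤ v (x + y)

/-- A valuation of the quotient field is supported on `S` if it is nonnegative on `S`. -/
def ValuationOn.Supported (w : ValuationOn S) : Prop :=
  ∀ x : S, x ≠ 0 → 0 ≤ w.v (algebraMap S (FractionRing S) x)

/-- `v(I) = min { v x : x ∈ I, x ≠ 0 }`. -/
noncomputable def idealVal (w : ValuationOn S) (I : Ideal S) : ℤ :=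
  sInf {m : ℤ | ∃ x ∈ I, x ≠ 0 ∧ w.v (algebraMap S (FractionRing S) x) = m}

/-- The skew Waldschmidt constant `v̂(a) = inf_{n ≥ 1} v(a n) / n (= lim_{n → ∞} v(a n)/n)`. -/
noncomputable def skewWald (w : ValuationOn S) (a : ℕ → Ideal S) : ℝ :=
  sInf {t : ℝ | ∃ n : ℕ, 0 < n ∧ t = (idealVal w (a n) : ℝ) / (n : ℝ)}

/-- `β_n^v(a, b) = inf { d ≥ 1 : v(a n) < v(b d) }`, with `inf ∅ = ∞`. -/
noncomputable def betaVal (w : ValuationOn S) (a b : ℕ → Ideal S) (n : ℕ) : ℕ∞ :=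
  sInf {d : ℕ∞ | ∃ m : ℕ, 0 < m ∧ idealVal w (a n) < idealVal w (b m) ∧ d = (m : ℕ∞)}

end Valuations

section Domains

/-- `S` is a finitely generated algebra over a field. -/
structure FieldBase (S : Type u) [CommRing S] where
  F : Type u
  [fld : Field F]
  [alg : Algebra F S]
  fg : Algebra.FiniteType F S

/-- `S` is finitely generated over a Noetherian integrally closed domain `R` with the
property that every finitely generated `R`-algebra (domain) has module-finite integral
closure (in its fraction field). -/
structure NagataBase (S : Type u) [CommRing S] where
  R : Type u
  [cring : CommRing R]
  [dom : IsDomain R]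
  [noeth : IsNoetherianRing R]
  [intClosed : IsIntegrallyClosed R]
  [alg : Algebra R S]
  fg : Algebra.FiniteType R S
  finiteIntegralClosure : ∀ (A : Type u) [CommRing A] [IsDomain A] [Algebra R A],
    Algebra.FiniteType R A → Module.Finite A (integralClosure A (FractionRing A))

/-- `S` is a complete local Noetherian ring, or finitely generated over a field or over `ℤ`,
or, more generally, finitely generated over a Noetherian integrally closed domain `R` such
that every finitely generated `R`-algebra has a module-finite integral closure. -/
def AdmissibleDomain (S : Type u) [CommRing S] : Prop :=
  (IsNoetherianRing S ∧ ∃ m : Ideal S, m.IsMaximal ∧ (∀ I : Ideal S, I.IsMaximal → I = m) ∧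
    IsAdicComplete m S)
  ∨ Nonempty (FieldBase S) ∨ Algebra.FiniteType ℤ S ∨ Nonempty (NagataBase S)

end Domains

section Comparison

variable {S : Type u} [CommRing S]

/-- The integral closures of the powers of `bb` are linearly bounded by the powers of `bb`. -/
def LinearlyBoundedClosure (bb : Ideal S) : Prop :=
  ∃ k : ℕ, ∀ n : ℕ, intClosure (bb ^ (n + k)) ≤ bb ^ n

lemma intClosure_mono {I J : Ideal S} (h : I ≤ J) : intClosure I ≤ intClosure J := by
  refine Ideal.span_mono ?_
  rintro x ⟨n, hn, c, hc, hx⟩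
  exact ⟨n, hn, c, fun i h1 h2 => Ideal.pow_right_mono h i (hc i h1 h2), hx⟩

lemma mem_intClosure_of_pow_mem {I : Ideal S} {x : S} {q : ℕ} (hq : 0 < q)
    (hx : x ^ q ∈ I ^ q) : x ∈ intClosure I := by
  refine Ideal.subset_span ⟨q, hq, fun i => if i = q then -x ^ q else 0, ?_, ?_⟩
  · intro i _ _
    by_cases h : i = q
    · subst h; simpa using hx
    · simp [h]
  · rw [Finset.sum_eq_single q]
    · simp
    · intro i _ h; simp [h]
    · intro h; exact absurd (Finset.mem_Icc.2 ⟨hq, le_rfl⟩) h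

lemma le_intClosure (I : Ideal S) : I ≤ intClosure I := fun x hx =>
  mem_intClosure_of_pow_mem one_pos (by simpa using hx)

lemma GradedFamily.pow_mem {a : ℕ → Ideal S} (ha : GradedFamily a) {n : ℕ} {x : S}
    (hx : x ∈ a n) (q : ℕ) : x ^ q ∈ a (n * q) := by
  induction q with
  | zero => simp [ha.1]
  | succ q ih => 
    rw [pow_succ, Nat.mul_succ]
    exact ha.2 _ _ (Ideal.mul_mem_mul ih hx)

lemma IdealFiltration.antitone {a : ℕ → Ideal S} (ha : IdealFiltration a) : Antitone a :=
  antitone_nat_of_succ_le ha.2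

/-- A family of ideals cofinal with the powers of `bb`, up to a bounded shift. -/
def PowerCofinal (bb : Ideal S) (g : ℕ → Ideal S) : Prop :=
  ∃ k : ℕ, ∀ i : ℕ, 1 ≤ i → bb ^ i ≤ g i ∧ g (i + k) ≤ bb ^ i

lemma asympResurgence_le_rhoLim {a : ℕ → Ideal S} {bb : Ideal S} {g g' : ℕ → Ideal S}
    (hg : PowerCofinal bb g) (hg' : PowerCofinal bb g') :
    asympResurgence a g ≤ rhoLim a g' := by
  obtain ⟨k, hk⟩ := hg
  obtain ⟨k', hk'⟩ := hg'
  refine sSup_le ?_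
  rintro _ ⟨s, r, hs, hr, hev, rfl⟩
  refine le_iInf fun n => ?_
  refine le_of_forall_lt fun y hy => ?_
  obtain ⟨z, hyz, hz⟩ := EReal.lt_iff_exists_real_btwn.1 hy
  have hz' : z < (s : ℝ) / r := by exact_mod_cast hz
  have hlim : Tendsto (fun t : ℕ => ((s * t : ℕ) : ℝ) / ((r * t + k' : ℕ) : ℝ)) atTop
      (nhds ((s : ℝ) / r)) := by
    have h1 : Tendsto (fun t : ℕ => (s : ℝ) / (r + k' / (t : ℝ))) atTop
        (nhds ((s : ℝ) / (r + 0))) := by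
      refine Tendsto.div tendsto_const_nhds ?_ (by simp; omega)
      exact tendsto_const_nhds.add (tendsto_const_div_atTop_nhds_zero_nat _)
    rw [add_zero] at h1
    refine h1.congr' ?_
    filter_upwards [eventually_gt_atTop 0] with t ht
    have : (t : ℝ) ≠ 0 := by positivity
    push_cast
    field_simp
  obtain ⟨t, ht, htz, htn⟩ := (hev.and ((hlim.eventually_const_lt hz').and
    (eventually_ge_atTop (n + 1)))).exists
  refine lt_of_lt_of_le hyz ?_
  have hrt : 1 ≤ r * t := Nat.mul_pos hr (by omega)
  have hst : n < s * t := lt_of_lt_of_le (by omega) (Nat.le_mul_of_pos_left t hs)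
  have hnot : ¬ a (s * t) ≤ g' (r * t + k') := fun h =>
    ht (h.trans (((hk' _ hrt).2).trans (hk _ hrt).1))
  have hb : betaIdx a g' (s * t) ≤ ((r * t + k' : ℕ) : ℕ∞) :=
    sInf_le ⟨_, by omega, hnot, rfl⟩
  obtain ⟨d, hd⟩ := ENat.ne_top_iff_exists.1 (ne_top_of_le_ne_top (ENat.natCast_ne_top _) hb)
  rw [← hd] at hb
  have hdle : d ≤ r * t + k' := by exact_mod_cast hb
  have hd0 : 0 < d := by
    have hmem := csInf_mem (s := {d : ℕ∞ | ∃ m : ℕ, 0 < m ∧ ¬ a (s * t) ≤ g' m ∧ d = (m : ℕ∞)})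
      ⟨_, _, by omega, hnot, rfl⟩
    obtain ⟨m, hm, -, hm'⟩ := hmem
    have : (d : ℕ∞) = m := hd.trans hm'
    have : d = m := by exact_mod_cast this
    omega
  refine le_trans ?_ (le_sSup ⟨s * t, d, hst.le, by omega, hd.symm, rfl⟩)
  rw [EReal.coe_le_coe_iff]
  refine htz.le.trans ?_
  have : (d : ℝ) ≤ ((r * t + k' : ℕ) : ℝ) := by exact_mod_cast hdle
  gcongr

/-- Frequent containments `a (s t) ⊆ g (r t)` bound the whole filtration `a`. -/
lemma le_intClosure_pow_of_frequently {a : ℕ → Ideal S} (ha : IdealFiltration a)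
    {bb : Ideal S} {g : ℕ → Ideal S} (hg : PowerCofinal bb g) {s r : ℕ}
    (hf : ∃ᶠ t : ℕ in atTop, a (s * t) ≤ g (r * t)) {n j : ℕ} (hn : 0 < n)
    (hj : j * s < n * r) : a n ≤ intClosure (bb ^ j) := by
  obtain ⟨k, hk⟩ := hg
  intro x hx
  have hr : 0 < r := Nat.pos_of_ne_zero (by rintro rfl; simp at hj)
  obtain ⟨t, ht, htb⟩ := (hf.and_eventually (eventually_ge_atTop (n * (k + 1) + n * j))).exists
  set q := s * t / n + 1 with hq
  have hnq : s * t ≤ n * q := by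
    have := Nat.div_add_mod (s * t) n
    have := Nat.mod_lt (s * t) hn
    rw [hq, Nat.mul_succ]; omega
  have hnq' : n * q ≤ s * t + n := by
    have := Nat.div_mul_le_self (s * t) n
    rw [hq, Nat.mul_succ, mul_comm n]; omega
  have hjq : j * q + k + 1 ≤ r * t := by
    have h1 : n * (j * q + k + 1) ≤ n * (r * t) := by
      calc n * (j * q + k + 1) = j * (n * q) + n * (k + 1) := by ring
        _ ≤ j * (s * t + n) + n * (k + 1) := by gcongr
        _ = j * s * t + (n * (k + 1) + n * j) := by ring
        _ ≤ j * s * t + t := by gcongr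
        _ = (j * s + 1) * t := by ring
        _ ≤ n * r * t := by gcongr; omega
        _ = n * (r * t) := by ring
    exact Nat.le_of_mul_le_mul_left h1 hn
  refine mem_intClosure_of_pow_mem (q := q) (Nat.succ_pos _) ?_
  have h1 : x ^ q ∈ g (r * t) := ht (ha.antitone hnq (ha.1.pow_mem hx q))
  have h2 := (hk (r * t - k) (by omega)).2
  rw [Nat.sub_add_cancel (by omega)] at h2
  rw [← pow_mul]
  exact Ideal.pow_le_pow_right (by omega) (h2 h1)

lemma rhoLim_le_of_frequently {a : ℕ → Ideal S} (ha : IdealFiltration a)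
    {bb : Ideal S} (hbb : LinearlyBoundedClosure bb) {g g' : ℕ → Ideal S}
    (hg : PowerCofinal bb g) (hg' : PowerCofinal bb g') {s r : ℕ} (hs : 0 < s) (hr : 0 < r)
    (hf : ∃ᶠ t : ℕ in atTop, a (s * t) ≤ g (r * t)) :
    rhoLim a g' ≤ (((s : ℝ) / (r : ℝ) : ℝ) : EReal) := by
  obtain ⟨k, hk⟩ := hbb
  obtain ⟨k', hk'⟩ := hg'
  refine le_of_forall_gt fun y hy => ?_
  obtain ⟨z, hz, hzy⟩ := EReal.lt_iff_exists_real_btwn.1 hy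
  have hz' : (s : ℝ) / r < z := by exact_mod_cast hz
  have hz0 : 0 < z := lt_of_le_of_lt (by positivity) hz'
  -- the index bound `β_n ≥ n r / s - k - 1`
  obtain ⟨N, hN⟩ := exists_nat_gt ((z * (k + 1)) / (z * r / s - 1))
  refine lt_of_le_of_lt ((iInf_le _ (N + 1)).trans (sSup_le ?_)) hzy
  rintro _ ⟨n, d, hn, hn0, hd, rfl⟩
  rw [EReal.coe_le_coe_iff]
  have hs' : (0 : ℝ) < s := by exact_mod_cast hs
  have hr' : (0 : ℝ) < r := by exact_mod_cast hr
  have hdpos : 0 < d ∧ ¬ a n ≤ g' d := by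
    have hne : {d : ℕ∞ | ∃ m : ℕ, 0 < m ∧ ¬ a n ≤ g' m ∧ d = (m : ℕ∞)}.Nonempty := by
      by_contra h
      rw [Set.not_nonempty_iff_eq_empty] at h
      rw [betaIdx, h, sInf_empty] at hd
      exact ENat.top_ne_natCast _ hd
    obtain ⟨m, hm, hm1, hm'⟩ := csInf_mem hne
    have : (d : ℕ∞) = m := hd.symm.trans hm'
    have : d = m := by exact_mod_cast this
    subst this; exact ⟨hm, hm1⟩
  have hkey : n * r ≤ (d + k) * s := by
    by_contra h
    push Not at h
    refine hdpos.2 (le_trans ?_ (hk' d hdpos.1).1)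
    exact (le_intClosure_pow_of_frequently ha hg hf (by omega) h).trans (hk d)
  have hkeyR : (n : ℝ) * r ≤ (d + k) * s := by exact_mod_cast hkey
  have hd' : (0 : ℝ) < d := by exact_mod_cast hdpos.1
  rw [div_le_iff₀ hd']
  have hpos : 0 < z * r / s - 1 := by
    rw [sub_pos, lt_div_iff₀ hs', one_mul]
    rwa [div_lt_iff₀ hr'] at hz'
  have hnN : (N : ℝ) ≤ n := by exact_mod_cast (by omega : N ≤ n)
  have h1 : z * (k + 1) ≤ n * (z * r / s - 1) := by
    have := (div_lt_iff₀ hpos).1 hN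
    nlinarith
  have h2 : z * (n * r / s) ≤ z * (d + k) := by
    gcongr
    rw [div_le_iff₀ hs']; exact hkeyR
  have h3 : (n : ℝ) * (z * r / s - 1) = z * (n * r / s) - n := by ring
  nlinarith

lemma not_le_of_not_mem_intClosure {a : ℕ → Ideal S} (ha : IdealFiltration a)
    {bb : Ideal S} {g : ℕ → Ideal S} (hg : PowerCofinal bb g) {j : ℕ} {x : S}
    (hx : x ∈ a 1) (hxj : x ∉ intClosure (bb ^ j)) :
    ((((1 : ℕ) : ℝ) / ((j + 1 : ℕ) : ℝ) : ℝ) : EReal) ≤ asympResurgence a g := by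
  obtain ⟨k, hk⟩ := hg
  refine le_sSup ⟨1, j + 1, one_pos, by omega, ?_, rfl⟩
  filter_upwards [eventually_ge_atTop (k + 1)] with t ht hle
  refine hxj (mem_intClosure_of_pow_mem (q := t) (by omega) ?_)
  have h1 : x ^ t ∈ g ((j + 1) * t) := hle (ha.1.pow_mem hx t)
  have h3 : (j + 1) * t = j * t + t := by ring
  have h2 := (hk ((j + 1) * t - k) (by omega)).2
  rw [Nat.sub_add_cancel (by omega)] at h2
  rw [← pow_mul]
  exact Ideal.pow_le_pow_right (by omega) (h2 h1)

lemma rhoLim_le_asympResurgence [IsDomain S] [IsNoetherianRing S]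
    {a : ℕ → Ideal S} (ha : IdealFiltration a) (ha1 : a 1 ≠ ⊥)
    {bb : Ideal S} (hbb : LinearlyBoundedClosure bb) {g g' : ℕ → Ideal S}
    (hg : PowerCofinal bb g) (hg' : PowerCofinal bb g') :
    rhoLim a g' ≤ asympResurgence a g := by
  by_cases htop : bb = ⊤
  · subst htop
    obtain ⟨k', hk'⟩ := hg'
    have : rhoN a g' 0 = ⊥ := by
      rw [rhoN, sSup_eq_bot]
      rintro _ ⟨s, d, -, -, hd, rfl⟩
      exfalso
      have : {d : ℕ∞ | ∃ m : ℕ, 0 < m ∧ ¬ a s ≤ g' m ∧ d = (m : ℕ∞)} = ∅ := by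
        rw [Set.eq_empty_iff_forall_notMem]
        rintro _ ⟨m, hm, hm', -⟩
        refine hm' (le_top.trans ?_)
        have := (hk' m hm).1
        rwa [Ideal.top_pow] at this
      rw [betaIdx, this, sInf_empty] at hd
      exact ENat.top_ne_natCast _ hd
    exact ((iInf_le _ 0).trans this.le).trans bot_le
  obtain ⟨x, hx, hx0⟩ := Submodule.exists_mem_ne_zero_of_ne_bot ha1
  obtain ⟨j, hj⟩ : ∃ j, x ∉ intClosure (bb ^ j) := by
    by_contra h
    push Not at h
    obtain ⟨k, hk⟩ := hbb
    have : x ∈ (⨅ i : ℕ, bb ^ i : Ideal S) := by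
      rw [Ideal.mem_iInf]
      exact fun i => hk i (h _)
    rw [Ideal.iInf_pow_eq_bot_of_isDomain bb htop] at this
    exact hx0 this
  have hpos : (0 : EReal) < asympResurgence a g := by
    refine lt_of_lt_of_le ?_ (not_le_of_not_mem_intClosure ha hg hx hj)
    exact_mod_cast (by positivity : (0 : ℝ) < ((1 : ℕ) : ℝ) / ((j + 1 : ℕ) : ℝ))
  by_contra hlt
  push Not at hlt
  obtain ⟨q, hq1, hq2⟩ := EReal.lt_iff_exists_rat_btwn.1 hlt
  have hq0 : (0 : ℝ) < ((q : ℚ) : ℝ) := by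
    have := hpos.trans hq1
    exact_mod_cast this
  have hq0' : 0 < q := by exact_mod_cast hq0
  have hqe : ((q : ℚ) : ℝ) = ((q.num.toNat : ℕ) : ℝ) / ((q.den : ℕ) : ℝ) := by
    have h1 : ((q.num.toNat : ℕ) : ℤ) = q.num := Int.toNat_of_nonneg (Rat.num_pos.2 hq0').le
    have h2 : ((q.num.toNat : ℕ) : ℝ) = (q.num : ℝ) := by
      rw [← Int.cast_natCast, h1]
    rw [h2]
    exact Rat.cast_def q
  have hnum : 0 < q.num.toNat := by
    have := Rat.num_pos.2 hq0'
    omega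
  rw [hqe] at hq1 hq2
  refine absurd (rhoLim_le_of_frequently ha hbb hg hg' hnum q.den_pos ?_) (not_le.2 hq2)
  by_contra hnf
  rw [Filter.not_frequently] at hnf
  exact absurd (le_sSup ⟨_, _, hnum, q.den_pos, hnf, rfl⟩ : _ ≤ asympResurgence a g) (not_le.2 hq1)

theorem asympResurgence_eq_rhoLim [IsDomain S] [IsNoetherianRing S]
    {a b : ℕ → Ideal S} (ha : IdealFiltration a) (ha1 : a 1 ≠ ⊥)
    {bb : Ideal S} (hbb : LinearlyBoundedClosure bb) (heq : BEquivalent bb b) :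
    asympResurgence a (fun i => intClosure (b i)) =
        rhoLim a (fun i => intClosure (b i)) ∧
      rhoLim a (fun i => intClosure (b i)) = asympResurgence a b ∧
      asympResurgence a b = rhoLim a b := by
  have h1 : PowerCofinal bb b := by
    obtain ⟨k, hk⟩ := heq
    exact ⟨k, fun i hi => (hk i hi).symm⟩
  have h2 : PowerCofinal bb (fun i => intClosure (b i)) := by
    obtain ⟨k, hk⟩ := heq
    obtain ⟨l, hl⟩ := hbb
    refine ⟨l + k, fun i hi => ⟨(hk i hi).2.trans (le_intClosure _), ?_⟩⟩
    refine (intClosure_mono ?_).trans (hl i)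
    have := (hk (i + l) (by omega)).1
    rwa [add_assoc] at this
  exact ⟨(asympResurgence_le_rhoLim h2 h2).antisymm (rhoLim_le_asympResurgence ha ha1 hbb h2 h2),
    (rhoLim_le_asympResurgence ha ha1 hbb h1 h2).antisymm (asympResurgence_le_rhoLim h1 h2),
    (asympResurgence_le_rhoLim h1 h1).antisymm (rhoLim_le_asympResurgence ha ha1 hbb h1 h1)⟩

end Comparison

section TestElements

lemma intClosure_le_of_forall {S : Type u} [CommRing S] {I J : Ideal S}
    (h : ∀ x : S, ∀ n : ℕ, 0 < n → ∀ c : ℕ → S, (∀ i, 1 ≤ i → i ≤ n → c i ∈ I ^ i) →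
      x ^ n + ∑ i ∈ Finset.Icc 1 n, c i * x ^ (n - i) = 0 → x ∈ J) : intClosure I ≤ J :=
  Ideal.span_le.2 fun x ⟨n, hn, c, hc, hx⟩ => h x n hn c hc hx

lemma intClosure_bot {S : Type u} [CommRing S] [IsDomain S] :
    intClosure (⊥ : Ideal S) = ⊥ := by
  refine le_bot_iff.1 (intClosure_le_of_forall fun x n hn c hc hx => ?_)
  rw [Finset.sum_eq_zero, add_zero] at hx
  · exact eq_zero_of_pow_eq_zero hx
  · intro i hi
    rw [Finset.mem_Icc] at hi
    have := hc i hi.1 hi.2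
    rw [Ideal.bot_pow (by omega), Ideal.mem_bot] at this
    rw [this, zero_mul]

lemma linearlyBoundedClosure_bot {S : Type u} [CommRing S] [IsDomain S] :
    LinearlyBoundedClosure (⊥ : Ideal S) := by
  refine ⟨1, fun n => ?_⟩
  rw [Ideal.bot_pow (by omega), intClosure_bot]
  exact bot_le

/-- A uniform multiplier into the powers of `bb` bounds the integral closures linearly,
by the Artin-Rees lemma. -/
lemma LinearlyBoundedClosure.of_multiplier {S : Type u} [CommRing S] [IsDomain S]
    [IsNoetherianRing S] {bb : Ideal S} {c : S} (hc : c ≠ 0)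
    (h : ∀ n : ℕ, ∀ x ∈ intClosure (bb ^ n), c * x ∈ bb ^ n) : LinearlyBoundedClosure bb := by
  obtain ⟨k, hk⟩ := bb.exists_pow_inf_eq_pow_smul (M := S) (Ideal.span {c})
  refine ⟨k, fun n x hx => ?_⟩
  have h1 := hk (n + k) (by omega)
  have h2 : c * x ∈ (bb ^ (n + k) • ⊤ ⊓ Ideal.span {c} : Submodule S S) := by
    refine ⟨?_, Ideal.mem_span_singleton.2 (dvd_mul_right _ _)⟩
    simpa using h _ x hx
  rw [h1, Nat.add_sub_cancel] at h2
  have h3 : c * x ∈ bb ^ n * Ideal.span {c} :=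
    (smul_mono_right (bb ^ n) inf_le_right :
      bb ^ n • (bb ^ k • ⊤ ⊓ Ideal.span {c} : Submodule S S) ≤ _) h2
  obtain ⟨y, hy, hyx⟩ := Ideal.mem_mul_span_singleton.1 h3
  rw [mul_comm y c] at hyx
  rwa [← mul_left_cancel₀ hc hyx]

/-- If a ring `T` of power series with `n`-th coefficient in `bb ^ n`, containing all monomials
of this kind, has a module-finite integral closure then the closures of powers of `bb` are
linearly bounded. -/
theorem LinearlyBoundedClosure.of_finite_integralClosure {S : Type u} [CommRing S] [IsDomain S]
    [IsNoetherianRing S] {bb : Ideal S} {T : Type u} [CommRing T] [IsDomain T]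
    (φ : T →+* PowerSeries S) (hφ : Function.Injective φ)
    (hcoeff : ∀ f n, PowerSeries.coeff n (φ f) ∈ bb ^ n)
    (hmono : ∀ n, ∀ r ∈ bb ^ n, ∃ f, φ f = PowerSeries.monomial n r)
    [hfin : Module.Finite T (integralClosure T (FractionRing T))] :
    LinearlyBoundedClosure bb := by
  by_cases hbot : bb = ⊥
  · subst hbot; exact linearlyBoundedClosure_bot
  obtain ⟨f, hf, hf0⟩ := Submodule.exists_mem_ne_zero_of_ne_bot hbot
  obtain ⟨c, hc, hcz⟩ := FractionalIdeal.isFractional_of_fg (R := T) (S := nonZeroDivisors T)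
    (P := FractionRing T) (I := (integralClosure T (FractionRing T)).toSubmodule)
    (Module.Finite.iff_fg.1 hfin)
  have hc0 : φ c ≠ 0 := by
    rw [Ne, map_eq_zero_iff φ hφ]; exact nonZeroDivisors.ne_zero hc
  obtain ⟨m, hm⟩ := (PowerSeries.exists_coeff_ne_zero_iff_ne_zero).2 hc0
  refine LinearlyBoundedClosure.of_multiplier hm fun n => ?_
  suffices intClosure (bb ^ n) ≤
      Submodule.comap (LinearMap.mulLeft S (PowerSeries.coeff m (φ c))) (bb ^ n)
    from fun x hx => this hx
  refine intClosure_le_of_forall fun x N hN a ha hx => ?_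
  change PowerSeries.coeff m (φ c) * x ∈ bb ^ n
  obtain ⟨u, hu⟩ := hmono 0 (f ^ n) (by simp)
  obtain ⟨v, hv⟩ := hmono n (x * f ^ n) (Ideal.mul_mem_left _ _ (Ideal.pow_mem_pow hf n))
  have hu0 : u ≠ 0 := by
    rintro rfl
    rw [map_zero] at hu
    have := congrArg (PowerSeries.coeff 0) hu
    simp at this
    exact hf0 (eq_zero_of_pow_eq_zero this.symm)
  have hb : ∀ i, ∃ w : T, 1 ≤ i → i ≤ N → φ w = PowerSeries.monomial (n * i) (a i) := by
    intro i
    by_cases h : 1 ≤ i ∧ i ≤ N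
    · obtain ⟨w, hw⟩ := hmono (n * i) (a i) (by rw [pow_mul]; exact ha i h.1 h.2)
      exact ⟨w, fun _ _ => hw⟩
    · exact ⟨0, fun h1 h2 => absurd ⟨h1, h2⟩ h⟩
  choose b hb using hb
  have hrel : v ^ N + ∑ i ∈ Finset.Icc 1 N, b i * u ^ i * v ^ (N - i) = 0 := by
    apply hφ
    rw [map_zero, map_add, map_pow, hv, map_sum]
    have : ∀ i ∈ Finset.Icc 1 N, φ (b i * u ^ i * v ^ (N - i)) =
        PowerSeries.monomial (n * N) (f ^ (n * N) * (a i * x ^ (N - i))) := by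
      intro i hi
      rw [Finset.mem_Icc] at hi
      obtain ⟨j, rfl⟩ := Nat.exists_eq_add_of_le hi.2
      rw [map_mul, map_mul, map_pow, map_pow, hu, hv, hb i hi.1 hi.2, Nat.add_sub_cancel_left]
      rw [PowerSeries.monomial_pow, PowerSeries.monomial_pow, PowerSeries.monomial_mul_monomial,
        PowerSeries.monomial_mul_monomial]
      rw [show n * i + i * 0 + j * n = n * (i + j) by ring]
      congr 1
      ring
    rw [Finset.sum_congr rfl this, ← map_sum, ← Finset.mul_sum, PowerSeries.monomial_pow,
      show N * n = n * N from mul_comm _ _, ← map_add]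
    rw [show (x * f ^ n) ^ N + f ^ (n * N) * ∑ i ∈ Finset.Icc 1 N, a i * x ^ (N - i) =
      f ^ (n * N) * (x ^ N + ∑ i ∈ Finset.Icc 1 N, a i * x ^ (N - i)) by ring, hx, mul_zero,
      map_zero]
  set z : FractionRing T := algebraMap T _ v / algebraMap T _ u with hz
  have hu0' : algebraMap T (FractionRing T) u ≠ 0 := by
    rwa [Ne, map_eq_zero_iff _ (IsFractionRing.injective T _)]
  have hzrel : z ^ N + ∑ i ∈ Finset.Icc 1 N, algebraMap T (FractionRing T) (b i) * z ^ (N - i)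
      = 0 := by
    refine (mul_eq_zero.1 ?_).resolve_left (pow_ne_zero N hu0')
    rw [mul_add, Finset.mul_sum, ← map_zero (algebraMap T (FractionRing T)), ← hrel, map_add,
      map_sum, map_pow]
    congr 1
    · rw [← mul_pow, hz, mul_div_cancel₀ _ hu0']
    · refine Finset.sum_congr rfl fun i hi => ?_
      rw [Finset.mem_Icc] at hi
      obtain ⟨j, rfl⟩ := Nat.exists_eq_add_of_le hi.2
      rw [Nat.add_sub_cancel_left, hz, map_mul, map_mul, map_pow, map_pow, pow_add, div_pow]
      field_simp
  have hzint : IsIntegral T z := by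
    refine ⟨Polynomial.X ^ N + ∑ i ∈ Finset.Icc 1 N,
      Polynomial.C (b i) * Polynomial.X ^ (N - i), ?_, ?_⟩
    · refine Polynomial.monic_X_pow_add ?_
      refine lt_of_le_of_lt (Polynomial.degree_sum_le _ _) ?_
      rw [Finset.sup_lt_iff (by exact WithBot.bot_lt_coe N)]
      intro i hi
      rw [Finset.mem_Icc] at hi
      refine lt_of_le_of_lt (Polynomial.degree_C_mul_X_pow_le _ _) ?_
      exact_mod_cast (by omega : N - i < N)
    · simpa [Polynomial.eval₂_finsetSum] using hzrel
  obtain ⟨w, hw⟩ := hcz z hzint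
  have hcv : c * v = w * u := by
    apply IsFractionRing.injective T (FractionRing T)
    rw [map_mul, map_mul, hw, Algebra.smul_def, hz]
    field_simp
  have := congrArg (PowerSeries.coeff (m + n)) (congrArg φ hcv)
  rw [map_mul φ, map_mul φ, hv, hu,
    PowerSeries.monomial_eq_C_mul_X_pow (x * f ^ n), ← mul_assoc,
    PowerSeries.coeff_mul_X_pow, PowerSeries.monomial_zero_eq_C_apply, PowerSeries.coeff_mul_C,
    PowerSeries.coeff_mul_C, ← mul_assoc] at this
  have := mul_right_cancel₀ (pow_ne_zero n hf0) this
  rw [this]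
  exact Ideal.pow_le_pow_right (by omega) (hcoeff w (m + n))

theorem LinearlyBoundedClosure.of_reesAlgebra {S : Type u} [CommRing S] [IsDomain S]
    [IsNoetherianRing S] {bb : Ideal S}
    [hfin : Module.Finite (reesAlgebra bb)
      (integralClosure (reesAlgebra bb) (FractionRing (reesAlgebra bb)))] :
    LinearlyBoundedClosure bb := by
  refine LinearlyBoundedClosure.of_finite_integralClosure (T := reesAlgebra bb)
    (Polynomial.coeToPowerSeries.ringHom.comp (reesAlgebra bb).val.toRingHom) ?_ ?_ ?_
  · exact (Polynomial.coe_injective S).comp Subtype.val_injective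
  · intro f n
    have : PowerSeries.coeff n ((f : S[X]) : PowerSeries S) ∈ bb ^ n := by
      rw [Polynomial.coeff_coe]; exact f.2 n
    exact this
  · intro n r hr
    exact ⟨⟨Polynomial.monomial n r, reesAlgebra.monomial_mem.2 hr⟩,
      Polynomial.coe_monomial n r⟩

theorem LinearlyBoundedClosure.of_nagataBase {S : Type u} [CommRing S] [IsDomain S]
    [IsNoetherianRing S] (h : NagataBase S) (bb : Ideal S) : LinearlyBoundedClosure bb := by
  obtain ⟨R, fg, hR⟩ := h
  have : Algebra.FiniteType R (reesAlgebra bb) := Algebra.FiniteType.trans fg inferInstance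
  have := hR (reesAlgebra bb) this
  exact LinearlyBoundedClosure.of_reesAlgebra

end TestElements

section FiniteIntegralClosure

lemma Module.Finite.integralClosure_of_algHom {R L M : Type*} [CommRing R] [IsNoetherianRing R]
    [CommRing L] [CommRing M] [Algebra R L] [Algebra R M] (f : L →ₐ[R] M)
    (hf : Function.Injective f) [Module.Finite R (integralClosure R M)] :
    Module.Finite R (integralClosure R L) :=
  Module.Finite.of_injective (f.mapIntegralClosure).toLinearMap fun _ _ h =>
    Subtype.ext (hf (congrArg Subtype.val h))

/-- Integral closures over an integral extension `R'` of `R` inside an `R'`-algebra. -/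
lemma Module.Finite.integralClosure_of_tower {R R' M : Type*} [CommRing R] [IsNoetherianRing R]
    [CommRing R'] [CommRing M] [Algebra R R'] [Algebra R M] [Algebra R' M] [IsScalarTower R R' M]
    [Module.Finite R R'] [Module.Finite R' (integralClosure R' M)] :
    Module.Finite R (integralClosure R M) := by
  have : Module.Finite R (integralClosure R' M) := Module.Finite.trans R' _
  refine Module.Finite.of_injective
    (N := integralClosure R' M) (R := R) (S := R) (σ := RingHom.id R)
    { toFun := fun x => (⟨x.1, IsIntegral.tower_top x.2⟩ : integralClosure R' M)
      map_add' := fun _ _ => rfl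
      map_smul' := fun _ _ => rfl } fun x y h => Subtype.ext (congrArg (fun z => z.1) h)

/-- The closure over a finite extension `A` of `R` is a finite `A`-module if the closure over `R`
is a finite `R`-module. -/
lemma Module.Finite.integralClosure_tower_top {R A M : Type*} [CommRing R]
    [CommRing A] [CommRing M] [Algebra R A] [Algebra R M] [Algebra A M] [IsScalarTower R A M]
    [Algebra.IsIntegral R A] [Module.Finite R (integralClosure R M)] :
    Module.Finite A (integralClosure A M) := by
  have : Module.Finite R (integralClosure A M) := by
    refine Module.Finite.of_surjective (M := integralClosure R M) (R := R) (S := R)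
      (σ := RingHom.id R)
      { toFun := fun x => (⟨x.1, IsIntegral.tower_top x.2⟩ : integralClosure A M)
        map_add' := fun _ _ => rfl
        map_smul' := fun _ _ => rfl } fun y => ?_
    exact ⟨⟨y.1, isIntegral_trans (A := A) y.1 y.2⟩, rfl⟩
  exact Module.Finite.of_restrictScalars_finite R A _

variable (R : Type u) [CommRing R] [IsDomain R]

/-- A domain all of whose integral closures in finite extensions of the fraction field are
module-finite. -/
def HasFiniteClosures : Prop :=
  ∀ (L : Type u) [Field L] [Algebra R L] [Algebra (FractionRing R) L]
    [IsScalarTower R (FractionRing R) L] [FiniteDimensional (FractionRing R) L],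
    Module.Finite R (integralClosure R L)

variable {R}

lemma HasFiniteClosures.of_algebraicClosure [IsNoetherianRing R]
    (h : ∀ L : IntermediateField (FractionRing R) (AlgebraicClosure (FractionRing R)),
      FiniteDimensional (FractionRing R) L → Module.Finite R (integralClosure R L)) :
    HasFiniteClosures R := by
  intro L _ _ _ _ _
  let f : L →ₐ[FractionRing R] AlgebraicClosure (FractionRing R) := IsAlgClosed.lift
  have : FiniteDimensional (FractionRing R) f.fieldRange :=
    f.equivFieldRange.toLinearEquiv.finiteDimensional
  have := h f.fieldRange this
  exact Module.Finite.integralClosure_of_algHom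
    ((f.equivFieldRange.restrictScalars R).toAlgHom) f.equivFieldRange.injective

lemma HasFiniteClosures.of_charZero [IsNoetherianRing R] [IsIntegrallyClosed R] [CharZero R] :
    HasFiniteClosures R := by
  intro L _ _ _ _ _
  have : CharZero (FractionRing R) :=
    charZero_of_injective_algebraMap (IsFractionRing.injective R (FractionRing R))
  exact IsIntegralClosure.finite R (FractionRing R) L (integralClosure R L)

/-- For a normal Noetherian domain it suffices to find, for finitely many elements which are
`p`-power roots of elements of `R`, a finite extension containing them in which the integral
closure of `R` is module-finite. -/
theorem HasFiniteClosures.of_roots [IsNoetherianRing R] [IsIntegrallyClosed R]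
    (h : ∀ (s : Finset (AlgebraicClosure (FractionRing R))) (e : ℕ),
      (∀ d ∈ s, ∃ r : R, algebraMap R (AlgebraicClosure (FractionRing R)) r =
        d ^ ringExpChar (FractionRing R) ^ e) →
      ∃ P : IntermediateField (FractionRing R) (AlgebraicClosure (FractionRing R)),
        FiniteDimensional (FractionRing R) P ∧ (∀ d ∈ s, d ∈ P) ∧
        Module.Finite R (integralClosure R P)) :
    HasFiniteClosures R := by
  refine HasFiniteClosures.of_algebraicClosure fun L hL => ?_
  set K := FractionRing R
  set Ω := AlgebraicClosure K
  set p := ringExpChar K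
  let b := Module.finBasis K L
  let Q := perfectClosure K Ω
  classical
  let s₀ : Finset Ω := Finset.univ.biUnion fun i =>
    ((minpoly Q (b i : Ω)).coeffs).image (algebraMap Q Ω)
  have hs₀ : ∀ d ∈ s₀, d ∈ Q := by
    intro d hd
    simp only [s₀, Finset.mem_biUnion, Finset.mem_image] at hd
    obtain ⟨i, -, c, -, rfl⟩ := hd
    exact c.2
  have hexp : ∀ d ∈ s₀, ∃ n, d ^ p ^ n ∈ (algebraMap K Ω).range := fun d hd =>
    mem_perfectClosure_iff.1 (hs₀ d hd)
  choose! ex hex using hexp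
  let e := s₀.sup ex
  have he : ∀ d ∈ s₀, ∃ k : K, algebraMap K Ω k = d ^ p ^ e := by
    intro d hd
    obtain ⟨k, hk⟩ := hex d hd
    obtain ⟨c, hc⟩ := Nat.exists_eq_add_of_le (Finset.le_sup (f := ex) hd)
    refine ⟨k ^ p ^ c, ?_⟩
    change _ = d ^ p ^ (s₀.sup ex)
    rw [map_pow, hk, hc, pow_add, pow_mul]
  have hden : ∀ d ∈ s₀, ∃ m : R, m ≠ 0 ∧ ∃ r : R, algebraMap R Ω r =
      (algebraMap R Ω m * d) ^ p ^ e := by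
    intro d hd
    obtain ⟨k, hk⟩ := he d hd
    obtain ⟨r, m, hm, rfl⟩ := IsFractionRing.div_surjective (A := R) k
    have hm0 := nonZeroDivisors.ne_zero hm
    have hm0' : algebraMap R Ω m ≠ 0 := by
      rw [IsScalarTower.algebraMap_apply R K Ω, Ne, map_eq_zero_iff _ (algebraMap K Ω).injective,
        map_eq_zero_iff _ (IsFractionRing.injective R K)]
      exact hm0
    refine ⟨m, hm0, r * m ^ (p ^ e - 1), ?_⟩
    have hp : p ^ e ≠ 0 := pow_ne_zero _ (expChar_pos K p).ne'
    rw [mul_pow, ← hk, map_mul, map_div₀, ← IsScalarTower.algebraMap_apply R K Ω,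
      ← IsScalarTower.algebraMap_apply R K Ω, map_pow, mul_div_assoc', eq_div_iff hm0',
      mul_assoc, ← pow_succ, Nat.sub_add_cancel (Nat.one_le_iff_ne_zero.2 hp), mul_comm]
  choose! m hm0 hm using hden
  obtain ⟨P, hPfin, hsP, hPcl⟩ := h (s₀.image fun d => algebraMap R Ω (m d) * d) e (by
    intro d hd
    obtain ⟨d', hd', rfl⟩ := Finset.mem_image.1 hd
    exact hm d' hd')
  have hsP' : ∀ d ∈ s₀, d ∈ P := by
    intro d hd
    have h1 : algebraMap R Ω (m d) * d ∈ P := hsP _ (Finset.mem_image_of_mem _ hd)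
    have h2 : algebraMap R Ω (m d) ≠ 0 := by
      rw [IsScalarTower.algebraMap_apply R K Ω, Ne, map_eq_zero_iff _ (algebraMap K Ω).injective,
        map_eq_zero_iff _ (IsFractionRing.injective R K)]
      exact hm0 d hd
    have h3 : algebraMap R Ω (m d) ∈ P := by
      rw [IsScalarTower.algebraMap_apply R K Ω]; exact P.algebraMap_mem _
    have := P.div_mem h1 h3
    rwa [mul_div_cancel_left₀ _ h2] at this
  have hsep : ∀ i, IsSeparable P (b i : Ω) := by
    intro i
    have hQ : IsSeparable Q (b i : Ω) := Algebra.IsSeparable.isSeparable Q _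
    obtain ⟨f, hf⟩ := (Polynomial.mem_lifts (f := algebraMap P Ω)
      ((minpoly Q (b i : Ω)).map (algebraMap Q Ω))).1 (by
        rw [Polynomial.lifts_iff_coeff_lifts]
        intro n
        rw [Polynomial.coeff_map]
        by_cases hn : (minpoly Q (b i : Ω)).coeff n = 0
        · rw [hn, map_zero]; exact ⟨0, map_zero _⟩
        · refine ⟨⟨_, hsP' _ ?_⟩, rfl⟩
          refine Finset.mem_biUnion.2 ⟨i, Finset.mem_univ _, Finset.mem_image_of_mem _ ?_⟩
          exact Polynomial.coeff_mem_coeffs hn)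
    have hfs : f.Separable := by
      rw [← Polynomial.separable_map (algebraMap P Ω), hf, Polynomial.separable_map]
      exact hQ
    refine hfs.of_dvd (minpoly.dvd P _ ?_)
    rw [Polynomial.aeval_def, ← Polynomial.eval_map, hf, Polynomial.eval_map,
      ← Polynomial.aeval_def, minpoly.aeval]
  let M := IntermediateField.adjoin P (Set.range fun i => (b i : Ω))
  have : Algebra.IsSeparable P M := by
    rw [IntermediateField.isSeparable_adjoin_iff_isSeparable]
    rintro _ ⟨i, rfl⟩
    exact hsep i
  have : FiniteDimensional P M := by
    refine IntermediateField.finiteDimensional_adjoin ?_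
    rintro _ ⟨i, rfl⟩
    exact (hsep i).isIntegral
  let R' := integralClosure R P
  have : IsFractionRing R' P := integralClosure.isFractionRing_of_finite_extension K P
  have : IsIntegrallyClosed R' := integralClosure.isIntegrallyClosedOfFiniteExtension K
  have : IsNoetherianRing R' := IsNoetherianRing.of_finite R R'
  have : Module.Finite R' (integralClosure R' M) := IsIntegralClosure.finite R' P M _
  have : IsScalarTower R P Ω := IsScalarTower.of_algebraMap_eq fun x => rfl
  have : IsScalarTower R R' M := IsScalarTower.of_algebraMap_eq fun x => rfl
  have : Module.Finite R (integralClosure R M) :=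
    Module.Finite.integralClosure_of_tower (R' := R')
  have hLM : ∀ x : L, (x : Ω) ∈ M := by
    intro x
    rw [← b.sum_repr x]
    rw [AddSubmonoidClass.coe_finsetSum]
    refine sum_mem fun i _ => ?_
    have : ((b.repr x i • b i : L) : Ω) = algebraMap P Ω (algebraMap K P (b.repr x i)) * b i := by
      rw [← IsScalarTower.algebraMap_apply K P Ω, IntermediateField.coe_smul, Algebra.smul_def]
    rw [this]
    exact mul_mem (M.algebraMap_mem _) (IntermediateField.subset_adjoin _ _ ⟨i, rfl⟩)
  let f : L →ₐ[R] M :=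
    { toFun := fun x => ⟨x, hLM x⟩
      map_one' := rfl
      map_mul' := fun _ _ => rfl
      map_zero' := rfl
      map_add' := fun _ _ => rfl
      commutes' := fun _ => rfl }
  exact Module.Finite.integralClosure_of_algHom f fun x y hxy => by
    have := congrArg (fun z : M => (z : Ω)) hxy
    exact Subtype.ext this

lemma finiteDimensional_fractionRing_of_finiteType (R A K L : Type*) [CommRing R] [IsDomain R]
    [CommRing A] [IsDomain A] [Field K] [Field L] [Algebra R A] [Algebra R K] [IsFractionRing R K]
    [Algebra A L] [IsFractionRing A L] [Algebra R L] [Algebra K L] [IsScalarTower R A L]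
    [IsScalarTower R K L] [Algebra.FiniteType R A] [Algebra.IsAlgebraic R A] :
    FiniteDimensional K L := by
  have : Algebra.EssFiniteType A L := Algebra.EssFiniteType.of_isLocalization L (nonZeroDivisors A)
  have : Algebra.EssFiniteType R L := Algebra.EssFiniteType.comp R A L
  have : Algebra.EssFiniteType K L := Algebra.EssFiniteType.of_comp R K L
  have : Algebra.IsAlgebraic A L := IsLocalization.isAlgebraic L (nonZeroDivisors A)
  have : FaithfulSMul R L := by
    rw [faithfulSMul_iff_algebraMap_injective, IsScalarTower.algebraMap_eq R K L]
    exact (algebraMap K L).injective.comp (IsFractionRing.injective R K)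
  have : Algebra.IsAlgebraic R L := Algebra.IsAlgebraic.trans R A L
  have : Algebra.IsAlgebraic K L := IsFractionRing.comap_isAlgebraic_iff.1 this
  exact Algebra.finite_of_essFiniteType_of_isAlgebraic

/-- The closure of `R` in the fraction field of an algebraic extension of finite type. -/
theorem HasFiniteClosures.finite_integralClosure_fractionRing {R : Type u} [CommRing R]
    [IsDomain R] (hR : HasFiniteClosures R) (A : Type u) [CommRing A] [IsDomain A] [Algebra R A]
    [Algebra.FiniteType R A] [Algebra.IsAlgebraic R A]
    (hinj : Function.Injective (algebraMap R A)) :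
    Module.Finite R (integralClosure R (FractionRing A)) := by
  have hinj' : FaithfulSMul R (FractionRing A) := by
    rw [faithfulSMul_iff_algebraMap_injective, IsScalarTower.algebraMap_eq R A (FractionRing A)]
    exact (IsFractionRing.injective A _).comp hinj
  let _ : Algebra (FractionRing R) (FractionRing A) :=
    FractionRing.liftAlgebra R (FractionRing A)
  have : IsScalarTower R (FractionRing R) (FractionRing A) :=
    FractionRing.isScalarTower_liftAlgebra R (FractionRing A)
  have : FiniteDimensional (FractionRing R) (FractionRing A) :=
    finiteDimensional_fractionRing_of_finiteType R A _ _
  exact hR (FractionRing A)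

/-- A domain which is finite over a domain with finite closures has a finite integral closure. -/
theorem HasFiniteClosures.finite_integralClosure {R : Type u} [CommRing R] [IsDomain R]
    (hR : HasFiniteClosures R) (A : Type u) [CommRing A] [IsDomain A] [Algebra R A]
    [Module.Finite R A] (hinj : Function.Injective (algebraMap R A)) :
    Module.Finite A (integralClosure A (FractionRing A)) := by
  have := hR.finite_integralClosure_fractionRing A hinj
  exact Module.Finite.integralClosure_tower_top (R := R)

end FiniteIntegralClosure

section FieldBase

/-- A normal finite extension of `R` inside an overfield generates a finite field extension in
which the integral closure of `R` is module-finite. -/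
lemma exists_intermediateField_of_isIntegrallyClosed {R B Ω : Type u} [CommRing R] [IsDomain R]
    [IsNoetherianRing R] [CommRing B] [IsDomain B] [IsIntegrallyClosed B] [Field Ω] [Algebra R B]
    [Module.Finite R B] [Algebra R Ω] [Algebra (FractionRing R) Ω]
    [IsScalarTower R (FractionRing R) Ω] (ψ : B →ₐ[R] Ω) (hψ : Function.Injective ψ) :
    ∃ P : IntermediateField (FractionRing R) Ω,
      FiniteDimensional (FractionRing R) P ∧ (∀ b, ψ b ∈ P) ∧
      Module.Finite R (integralClosure R P) := by
  have hinj : Function.Injective (algebraMap R Ω) := by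
    rw [IsScalarTower.algebraMap_eq R (FractionRing R) Ω]
    exact (algebraMap (FractionRing R) Ω).injective.comp (IsFractionRing.injective R _)
  have hinj' : Function.Injective (algebraMap R B) := by
    have : algebraMap R Ω = (ψ : B →+* Ω).comp (algebraMap R B) := ψ.comp_algebraMap.symm
    rw [this] at hinj
    exact Function.Injective.of_comp hinj
  have hinj'' : FaithfulSMul R (FractionRing B) := by
    rw [faithfulSMul_iff_algebraMap_injective, IsScalarTower.algebraMap_eq R B (FractionRing B)]
    exact (IsFractionRing.injective B _).comp hinj'
  let _ : Algebra (FractionRing R) (FractionRing B) :=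
    FractionRing.liftAlgebra R (FractionRing B)
  have : IsScalarTower R (FractionRing R) (FractionRing B) :=
    FractionRing.isScalarTower_liftAlgebra R (FractionRing B)
  have : FiniteDimensional (FractionRing R) (FractionRing B) :=
    finiteDimensional_fractionRing_of_finiteType R B _ _
  let Φ₀ : FractionRing B →+* Ω := IsFractionRing.lift (g := (ψ : B →+* Ω)) hψ
  have hΦ₀ : ∀ b, Φ₀ (algebraMap B _ b) = ψ b := fun b => IsFractionRing.lift_algebraMap hψ b
  let Φ : FractionRing B →ₐ[FractionRing R] Ω :=
    { Φ₀ with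
      commutes' := by
        have : Φ₀.comp (algebraMap (FractionRing R) (FractionRing B)) =
            algebraMap (FractionRing R) Ω := by
          refine IsLocalization.ringHom_ext (nonZeroDivisors R) (RingHom.ext fun r => ?_)
          simp only [RingHom.comp_apply]
          rw [← IsScalarTower.algebraMap_apply, ← IsScalarTower.algebraMap_apply,
            IsScalarTower.algebraMap_apply R B, hΦ₀, ψ.commutes]
        exact fun r => RingHom.congr_fun this r }
  have : Module.Finite B (integralClosure B (FractionRing B)) := by
    have h := (IsIntegrallyClosed.integralClosure_eq_bot_iff (R := B) (FractionRing B)).2 ‹_›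
    rw [h]
    exact Module.Finite.of_surjective (Algebra.ofId B (⊥ : Subalgebra B (FractionRing B))).toLinearMap
      (by
        rintro ⟨x, hx⟩
        obtain ⟨y, rfl⟩ := Algebra.mem_bot.1 hx
        exact ⟨y, rfl⟩)
  have : Module.Finite R (integralClosure R (FractionRing B)) :=
    Module.Finite.integralClosure_of_tower (R' := B)
  refine ⟨Φ.fieldRange, Φ.equivFieldRange.toLinearEquiv.finiteDimensional,
    fun b => ⟨algebraMap B _ b, hΦ₀ b⟩, ?_⟩
  exact Module.Finite.integralClosure_of_algHom
    ((Φ.equivFieldRange.symm.restrictScalars R).toAlgHom) Φ.equivFieldRange.symm.injective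

theorem HasFiniteClosures.mvPolynomial (F : Type u) [Field F] (n : ℕ) :
    HasFiniteClosures (MvPolynomial (Fin n) F) := by
  refine HasFiniteClosures.of_roots fun s e hs => ?_
  let R := MvPolynomial (Fin n) F
  let K := FractionRing R
  let Ω := AlgebraicClosure K
  let p := ringExpChar K
  have : ExpChar Ω p := expChar_of_injective_algebraMap (algebraMap K Ω).injective p
  have : ExpChar F p := (algebraMap F Ω).expChar (algebraMap F Ω).injective p
  have hRΩ : Function.Injective (algebraMap R Ω) := by
    rw [IsScalarTower.algebraMap_eq R K Ω]
    exact (algebraMap K Ω).injective.comp (IsFractionRing.injective R _)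
  have hq : p ^ e ≠ 0 := pow_ne_zero _ (expChar_pos K p).ne'
  have hroot : ∀ c : Ω, ∃ z, z ^ p ^ e = c := fun c =>
    IsAlgClosed.exists_pow_nat_eq c (Nat.pos_of_ne_zero hq)
  choose ρ hρ using hroot
  choose! r hr using hs
  classical
  let Γ : Finset F := s.biUnion fun d => (r d).support.image fun m => (r d).coeff m
  let F' := IntermediateField.adjoin F (((Γ.image fun c => ρ (algebraMap F Ω c)) : Finset Ω) : Set Ω)
  have hintegral : ∀ c : F, IsIntegral F (ρ (algebraMap F Ω c)) := fun c =>
    IsIntegral.of_pow (Nat.pos_of_ne_zero hq) (by rw [hρ]; exact isIntegral_algebraMap)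
  have : FiniteDimensional F F' := by
    refine IntermediateField.finiteDimensional_adjoin fun x hx => ?_
    obtain ⟨c, -, rfl⟩ := Finset.mem_image.1 (Finset.mem_coe.1 hx)
    exact hintegral c
  have : ExpChar F' p := expChar_of_injective_algebraMap (algebraMap F F').injective p
  let x : Fin n → Ω := fun i => algebraMap R Ω (MvPolynomial.X i)
  have hx : MvPolynomial.aeval x = IsScalarTower.toAlgHom F R Ω :=
    MvPolynomial.algHom_ext fun i => MvPolynomial.aeval_X x i
  have hxF : AlgebraicIndependent F x := by
    rw [algebraicIndependent_iff_injective_aeval, hx]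
    exact hRΩ
  have hxF' : AlgebraicIndependent F' x := hxF.extendScalars F'
  let B := MvPolynomial (Fin n) F'
  let φ : R →ₐ[F] B := MvPolynomial.aeval fun i => MvPolynomial.X i ^ p ^ e
  let y : Fin n → Ω := fun i => ρ (x i)
  let ψ : B →ₐ[F'] Ω := MvPolynomial.aeval y
  have hψφ : ∀ t, ψ (φ t) = algebraMap R Ω t := by
    have : (ψ.restrictScalars F).comp φ = IsScalarTower.toAlgHom F R Ω :=
      MvPolynomial.algHom_ext fun i => by
        have h1 : φ (MvPolynomial.X i) = MvPolynomial.X i ^ p ^ e := MvPolynomial.aeval_X _ i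
        have h2 : ψ (MvPolynomial.X i) = y i := MvPolynomial.aeval_X y i
        change ψ (φ (MvPolynomial.X i)) = x i
        rw [h1, map_pow, h2, hρ]
    exact fun t => DFunLike.congr_fun this t
  have hfrob : ∀ g : B, ψ g ^ p ^ e =
      MvPolynomial.aeval x (MvPolynomial.map (iterateFrobenius F' p e) g) := by
    have : (iterateFrobenius Ω p e).comp (ψ : B →+* Ω) =
        ((MvPolynomial.aeval x : B →ₐ[F'] Ω) : B →+* Ω).comp
          (MvPolynomial.map (iterateFrobenius F' p e)) := by
      refine MvPolynomial.ringHom_ext (fun c => ?_) (fun i => ?_)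
      · change ψ (MvPolynomial.C c) ^ p ^ e = MvPolynomial.aeval x (MvPolynomial.map _ _)
        rw [MvPolynomial.map_C, MvPolynomial.algHom_C, MvPolynomial.algHom_C,
          iterateFrobenius_def, map_pow]
      · have h2 : ψ (MvPolynomial.X i) = y i := MvPolynomial.aeval_X y i
        change ψ (MvPolynomial.X i) ^ p ^ e = MvPolynomial.aeval x (MvPolynomial.map _ _)
        rw [MvPolynomial.map_X, h2, hρ, MvPolynomial.aeval_X]
    exact fun g => RingHom.congr_fun this g
  have hψinj : Function.Injective ψ := by
    rw [injective_iff_map_eq_zero]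
    intro g hg
    have h1 := hfrob g
    rw [hg, zero_pow hq] at h1
    have h2 := hxF'.eq_zero_of_aeval_eq_zero _ h1.symm
    exact (map_eq_zero_iff _ (MvPolynomial.map_injective _ (iterateFrobenius_inj F' p e))).1 h2
  let _ : Algebra R B := φ.toRingHom.toAlgebra
  have : IsScalarTower F R B := IsScalarTower.of_algebraMap_eq' φ.comp_algebraMap.symm
  have : Algebra.FiniteType F F' := inferInstance
  have : Algebra.FiniteType F B := Algebra.FiniteType.trans (S := F') inferInstance inferInstance
  have : Algebra.FiniteType R B := Algebra.FiniteType.of_restrictScalars_finiteType F R B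
  have : Algebra.IsIntegral R B := by
    refine ⟨fun b => ?_⟩
    induction b using MvPolynomial.induction_on with
    | C a =>
      have h1 : IsIntegral F a := Algebra.IsIntegral.isIntegral a
      have h2 : IsIntegral F (algebraMap F' B a) := h1.algebraMap
      exact h2.tower_top
    | add f g hf hg => exact hf.add hg
    | mul_X f i hf =>
      refine hf.mul (IsIntegral.of_pow (Nat.pos_of_ne_zero hq) ?_)
      have : (MvPolynomial.X i ^ p ^ e : B) = algebraMap R B (MvPolynomial.X i) := by
        exact (MvPolynomial.aeval_X (R := F) (fun i => (MvPolynomial.X i ^ p ^ e : B)) i).symm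
      rw [this]
      exact isIntegral_algebraMap
  have : Module.Finite R B := Algebra.IsIntegral.finite
  obtain ⟨P, hP, hmem, hfin⟩ := exists_intermediateField_of_isIntegrallyClosed
    (⟨ψ, hψφ⟩ : B →ₐ[R] Ω) hψinj
  refine ⟨P, hP, fun d hd => ?_, hfin⟩
  obtain ⟨g, hg⟩ : ∃ g : B, MvPolynomial.map (iterateFrobenius F' p e) g =
      MvPolynomial.map (algebraMap F F') (r d) := by
    change _ ∈ Set.range _
    rw [MvPolynomial.mem_range_map_iff_coeffs_subset]
    intro c hc
    obtain ⟨m, hm, rfl⟩ := MvPolynomial.mem_coeffs_iff.1 hc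
    rw [MvPolynomial.coeff_map]
    have hm' : m ∈ (r d).support := MvPolynomial.support_map_subset _ _ hm
    have hmem : (r d).coeff m ∈ Γ :=
      Finset.mem_biUnion.2 ⟨d, hd, Finset.mem_image_of_mem _ hm'⟩
    refine ⟨⟨ρ (algebraMap F Ω ((r d).coeff m)), IntermediateField.subset_adjoin _ _
      (Finset.mem_coe.2 (Finset.mem_image_of_mem _ hmem))⟩, ?_⟩
    exact Subtype.ext (hρ _)
  have h3 : ψ g ^ p ^ e = d ^ p ^ e := by
    rw [hfrob, hg, ← hr d hd, MvPolynomial.aeval_map_algebraMap, hx]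
    rfl
  have h4 : ψ g = d := iterateFrobenius_inj Ω p e h3
  rw [← h4]
  exact hmem g

variable {S : Type u} [CommRing S]

lemma finiteType_reesAlgebra [IsNoetherianRing S] (bb : Ideal S) :
    Algebra.FiniteType S (reesAlgebra bb) :=
  (reesAlgebra bb).fg_iff_finiteType.1 (reesAlgebra.fg (IsNoetherian.noetherian bb))

/-- A domain of finite type over a field has a module-finite integral closure. -/
theorem finite_integralClosure_of_finiteType_field (F : Type u) [Field F] (A : Type u) [CommRing A]
    [IsDomain A] [Algebra F A] [Algebra.FiniteType F A] :
    Module.Finite A (integralClosure A (FractionRing A)) := by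
  obtain ⟨s, g, hg, hfin⟩ := exists_finite_inj_algHom_of_fg F A
  let _ : Algebra (MvPolynomial (Fin s) F) A := g.toRingHom.toAlgebra
  have : Module.Finite (MvPolynomial (Fin s) F) A := hfin
  exact (HasFiniteClosures.mvPolynomial F s).finite_integralClosure A hg

lemma LinearlyBoundedClosure.of_fieldBase [IsDomain S] [IsNoetherianRing S] (h : FieldBase S)
    (bb : Ideal S) : LinearlyBoundedClosure bb := by
  obtain ⟨F, hfg⟩ := h
  have := finiteType_reesAlgebra bb
  have : Algebra.FiniteType F (reesAlgebra bb) := Algebra.FiniteType.trans (S := S) hfg this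
  have := finite_integralClosure_of_finiteType_field F (reesAlgebra bb)
  exact LinearlyBoundedClosure.of_reesAlgebra

end FieldBase

section IntegerBase

lemma Module.Finite.of_forall_maximal {A M : Type*} [CommRing A] [AddCommGroup M] [Module A M]
    (h : ∀ P : Ideal A, P.IsMaximal → ∃ r ∉ P, ∃ N : Submodule A M, N.FG ∧
      ∀ x : M, ∃ m : ℕ, r ^ m • x ∈ N) : Module.Finite A M := by
  classical
  choose! r hr N hN hx using h
  let s : Set A := {a | ∃ P : Ideal A, P.IsMaximal ∧ a = r P}
  have hs : Ideal.span s = ⊤ := by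
    by_contra hne
    obtain ⟨P, hP, hle⟩ := Ideal.exists_le_maximal _ hne
    exact hr P hP (hle (Ideal.subset_span ⟨P, hP, rfl⟩))
  obtain ⟨t, hts, ht⟩ := (Ideal.span_eq_top_iff_finite s).1 hs
  have hsP : ∀ a ∈ t, ∃ P : Ideal A, P.IsMaximal ∧ a = r P := fun a ha => hts ha
  choose! Q hQ hQr using hsP
  let L : Submodule A M := t.sup fun a => N (Q a)
  have hL : L.FG := Submodule.fg_finset_sup t _ fun a ha => hN _ (hQ a ha)
  refine ⟨?_⟩
  convert hL
  refine (eq_top_iff.2 fun x _ => ?_).symm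
  let J : Ideal A := L.colon {x}
  suffices hJ : J = ⊤ by
    have : (1 : A) ∈ J := hJ ▸ Submodule.mem_top
    simpa [J, Submodule.mem_colon_singleton] using this
  by_contra hne
  obtain ⟨P, hP, hle⟩ := Ideal.exists_le_maximal _ hne
  have : ∃ a ∈ t, a ∉ P := by
    by_contra! hcon
    exact hP.ne_top (top_le_iff.1 (ht ▸ Ideal.span_le.2 fun a ha => hcon a ha))
  obtain ⟨a, hat, haP⟩ := this
  obtain ⟨m, hm⟩ := hx _ (hQ a hat) x
  rw [← hQr a hat] at hm
  refine haP (hP.isPrime.mem_of_pow_mem m (hle ?_))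
  rw [Submodule.mem_colon_singleton]
  exact Finset.le_sup (f := fun a => N (Q a)) hat hm

lemma exists_pow_mul_isIntegral_of_finite_quotient {R A : Type*} [CommRing R] [CommRing A]
    [Algebra R A] [Algebra.FiniteType R A] (P : Ideal A) [P.IsPrime] (I : Ideal A)
    (hI : I ≤ (P.under R).map (algebraMap R A)) [Module.Finite R (A ⧸ I)] :
    ∃ h ∉ P, IsIntegral R h ∧ ∀ x : A, ∃ m : ℕ, IsIntegral R (h ^ m * x) := by
  have : Module.Finite R (A ⧸ (P.under R).map (algebraMap R A)) :=
    Module.Finite.of_surjective (Ideal.Quotient.factorₐ R hI).toLinearMap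
      (Ideal.Quotient.factor_surjective hI)
  have : Algebra.WeaklyQuasiFiniteAt R P := by
    unfold Algebra.WeaklyQuasiFiniteAt
    infer_instance
  exact Algebra.zariskisMainProperty_iff.1
    (Algebra.ZariskisMainProperty.of_finiteType_of_weaklyQuasiFiniteAt P)

lemma exists_pow_mul_isIntegral_of_isIntegral {R A L : Type*} [CommRing R] [CommRing A]
    [CommRing L] [Algebra R A] [Algebra A L] [Algebra R L] [IsScalarTower R A L] {h : A}
    (hh : IsIntegral R h) (hx : ∀ x : A, ∃ m : ℕ, IsIntegral R (h ^ m * x)) {x : L}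
    (hxA : IsIntegral A x) : ∃ m : ℕ, IsIntegral R (algebraMap A L h ^ m * x) := by
  obtain ⟨f, hf, hfx⟩ := hxA
  choose m hm using hx
  let M := ∑ i ∈ Finset.range f.natDegree, m (f.coeff i)
  have hM : ∀ i < f.natDegree, IsIntegral R (h ^ M * f.coeff i) := by
    intro i hi
    obtain ⟨c, hc⟩ := Nat.exists_eq_add_of_le (Finset.single_le_sum
      (f := fun i => m (f.coeff i)) (fun _ _ => Nat.zero_le _) (Finset.mem_range.2 hi))
    have : M = m (f.coeff i) + c := hc
    rw [this, pow_add, mul_right_comm]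
    exact (hm _).mul (hh.pow c)
  refine ⟨M, ?_⟩
  let g := f.scaleRoots (h ^ M)
  have hg : g.Monic := (Polynomial.monic_scaleRoots_iff _).2 hf
  have hgc : ∀ i, IsIntegral R (g.coeff i) := by
    intro i
    rw [Polynomial.coeff_scaleRoots]
    rcases lt_trichotomy i f.natDegree with hi | hi | hi
    · obtain ⟨c, hc⟩ := Nat.exists_eq_add_of_lt hi
      have : f.natDegree - i = c + 1 := by omega
      rw [this, pow_succ', ← mul_assoc, mul_comm (f.coeff i)]
      exact (hM i hi).mul ((hh.pow M).pow c)
    · subst hi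
      rw [hf.coeff_natDegree, Nat.sub_self, pow_zero, mul_one]
      exact isIntegral_one
    · rw [Polynomial.coeff_eq_zero_of_natDegree_lt hi, zero_mul]
      exact isIntegral_zero
  have hlift : g ∈ Polynomial.lifts (algebraMap (integralClosure R A) A) := by
    rw [Polynomial.lifts_iff_coeff_lifts]
    exact fun i => ⟨⟨g.coeff i, hgc i⟩, rfl⟩
  obtain ⟨q, hq, -, hqm⟩ := Polynomial.lifts_and_natDegree_eq_and_monic hlift hg
  have : IsIntegral (integralClosure R A) (algebraMap A L h ^ M * x) := by
    refine ⟨q, hqm, ?_⟩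
    rw [IsScalarTower.algebraMap_eq (integralClosure R A) A L, ← Polynomial.eval₂_map, hq,
      ← map_pow]
    exact Polynomial.scaleRoots_eval₂_eq_zero (algebraMap A L) hfx
  exact isIntegral_trans (R := R) (A := integralClosure R A) _ this

/-- If every maximal ideal of `A` admits a ring with finite closures over which `A` is quasi-finite
there, then `A` has a module-finite integral closure. -/
lemma exists_fg_of_pow_mul_isIntegral {R A : Type u} [CommRing R] [IsDomain R]
    (hR : HasFiniteClosures R) [CommRing A] [IsDomain A] [Algebra R A] [Algebra.FiniteType R A]
    (hinj : Function.Injective (algebraMap R A)) {h : A} (hh0 : h ≠ 0) (hh : IsIntegral R h)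
    (hx : ∀ x : A, ∃ m : ℕ, IsIntegral R (h ^ m * x)) :
    ∃ N : Submodule A (integralClosure A (FractionRing A)), N.FG ∧
      ∀ x, ∃ m : ℕ, h ^ m • x ∈ N := by
  have : FaithfulSMul R A := (faithfulSMul_iff_algebraMap_injective R A).2 hinj
  have : Algebra.IsAlgebraic R A := by
    refine ⟨fun x => ?_⟩
    obtain ⟨m, hm⟩ := hx x
    have h1 := hm.isAlgebraic
    have h2 := (hh.pow m).isAlgebraic
    exact IsAlgebraic.of_mul (mem_nonZeroDivisors_of_ne_zero (pow_ne_zero m hh0)) h2 h1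
  have hfin := hR.finite_integralClosure_fractionRing A hinj
  let C := integralClosure R (FractionRing A)
  let ι : C →ₗ[R] integralClosure A (FractionRing A) :=
    { toFun := fun x => ⟨x.1, IsIntegral.tower_top x.2⟩
      map_add' := fun _ _ => rfl
      map_smul' := fun _ _ => rfl }
  obtain ⟨s, hs⟩ := hfin.fg_top
  refine ⟨Submodule.span A (ι '' s), Submodule.fg_span (s.finite_toSet.image _), fun x => ?_⟩
  obtain ⟨m, hm⟩ := exists_pow_mul_isIntegral_of_isIntegral hh hx x.2
  refine ⟨m, ?_⟩
  let c : C := ⟨_, hm⟩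
  have hc : ι c = h ^ m • x := by
    refine Subtype.ext ?_
    change algebraMap A _ h ^ m * x.1 = h ^ m • x.1
    rw [Algebra.smul_def, map_pow]
  rw [← hc]
  have hmem : c ∈ Submodule.span R (s : Set C) := hs ▸ Submodule.mem_top
  have h1 := Submodule.mem_map_of_mem (f := ι) hmem
  rw [Submodule.map_span] at h1
  exact Submodule.span_subset_span R A _ h1

/-- A polynomial ring over the integers maps injectively and quasi-finitely, over `p`, to a
finitely generated domain of characteristic zero. -/
lemma exists_mvPolynomial_int_finite_quotient (A : Type u) [CommRing A] [IsDomain A] [CharZero A]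
    [Algebra.FiniteType ℤ A] (p : ℕ) [Fact p.Prime] (hp : Ideal.span {(p : A)} ≠ ⊤) :
    ∃ (n : ℕ) (φ : MvPolynomial (ULift.{u} (Fin n)) ℤ →+* A), Function.Injective φ ∧
      ((Ideal.Quotient.mk (Ideal.span {(p : A)})).comp φ).Finite := by
  let I := Ideal.span {(p : A)}
  have : Nontrivial (A ⧸ I) := Ideal.Quotient.nontrivial_iff.2 hp
  have hp0 : ((p : ℕ) : A ⧸ I) = 0 := by
    rw [← map_natCast (Ideal.Quotient.mk I)]
    exact Ideal.Quotient.eq_zero_iff_mem.2 (Ideal.mem_span_singleton_self _)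
  have : CharP (A ⧸ I) p := (CharP.charP_iff_prime_eq_zero Fact.out).2 hp0
  let _ : Algebra (ZMod p) (A ⧸ I) := ZMod.algebra (A ⧸ I) p
  have : IsScalarTower ℤ (ZMod p) (A ⧸ I) :=
    IsScalarTower.of_algebraMap_eq' (RingHom.ext_int _ _)
  have : Algebra.FiniteType ℤ (A ⧸ I) := inferInstance
  have : Algebra.FiniteType (ZMod p) (A ⧸ I) := Algebra.FiniteType.of_restrictScalars_finiteType ℤ _ _
  obtain ⟨n, g, hg, hgfin⟩ := exists_finite_inj_algHom_of_fg (ZMod p) (A ⧸ I)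
  choose t ht using fun i => Ideal.Quotient.mk_surjective (g (MvPolynomial.X i))
  let φ : MvPolynomial (ULift.{u} (Fin n)) ℤ →+* A :=
    (MvPolynomial.aeval fun i => t i.down : _ →ₐ[ℤ] A).toRingHom
  let red : MvPolynomial (ULift.{u} (Fin n)) ℤ →+* MvPolynomial (Fin n) (ZMod p) :=
    (MvPolynomial.rename ULift.down : _ →ₐ[ZMod p] _).toRingHom.comp
      (MvPolynomial.map (Int.castRingHom (ZMod p)))
  have hcomp : (Ideal.Quotient.mk I).comp φ = g.toRingHom.comp red := by
    refine MvPolynomial.ringHom_ext' (RingHom.ext_int _ _) fun i => ?_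
    simp [φ, red, ht]
  refine ⟨n, φ, ?_, ?_⟩
  · have hstep : ∀ f, φ f = 0 → ∃ f', φ f' = 0 ∧ f = (p : MvPolynomial _ ℤ) * f' := by
      intro f hf
      have h1 : g (red f) = 0 := by
        have := RingHom.congr_fun hcomp f
        simp only [RingHom.comp_apply, hf, map_zero] at this
        exact this.symm
      have h2 : red f = 0 := (map_eq_zero_iff g hg).1 h1
      have h3 : MvPolynomial.map (Int.castRingHom (ZMod p)) f = 0 :=
        (map_eq_zero_iff _ (MvPolynomial.rename_injective _ ULift.down_injective)).1 h2
      obtain ⟨f', rfl⟩ := (MvPolynomial.C_dvd_iff_zmod p f).2 h3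
      refine ⟨f', ?_, by simp⟩
      rw [map_mul] at hf
      refine (mul_eq_zero.1 hf).resolve_left ?_
      simpa [φ] using (Fact.out : p.Prime).ne_zero
    rw [injective_iff_map_eq_zero]
    intro f hf
    have hpow : ∀ k : ℕ, ∃ f', φ f' = 0 ∧ f = (p : MvPolynomial _ ℤ) ^ k * f' := by
      intro k
      induction k with
      | zero => exact ⟨f, hf, by simp⟩
      | succ k ih =>
        obtain ⟨f', hf', rfl⟩ := ih
        obtain ⟨f'', hf'', rfl⟩ := hstep f' hf'
        exact ⟨f'', hf'', by ring⟩
    have hJ : Ideal.span {(p : MvPolynomial (ULift.{u} (Fin n)) ℤ)} ≠ ⊤ := by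
      intro htop
      rw [Ideal.span_singleton_eq_top] at htop
      have := htop.map (MvPolynomial.map (Int.castRingHom (ZMod p)))
      simp at this
    have := Ideal.iInf_pow_eq_bot_of_isDomain _ hJ
    rw [← Ideal.mem_bot, ← this, Ideal.mem_iInf]
    intro k
    obtain ⟨f', -, rfl⟩ := hpow k
    rw [Ideal.span_singleton_pow]
    exact Ideal.mul_mem_right _ _ (Ideal.mem_span_singleton_self _)
  · rw [hcomp]
    refine RingHom.Finite.comp hgfin (RingHom.Finite.of_surjective _ ?_)
    refine Function.Surjective.comp (g := MvPolynomial.rename ULift.down)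
      (MvPolynomial.rename_surjective _ ULift.down_surjective) ?_
    exact MvPolynomial.map_surjective _ (ZMod.ringHom_surjective _)

lemma isJacobsonRing_int : IsJacobsonRing ℤ := by
  refine isJacobsonRing_iff_prime_eq.2 fun P hP => ?_
  by_cases hP0 : P = ⊥
  · subst hP0
    refine le_antisymm (fun x hx => ?_) Ideal.le_jacobson
    have h := Int.isUnit_iff.1 (Ideal.mem_jacobson_bot.1 hx x)
    rw [Ideal.mem_bot]
    rcases h with h | h <;> nlinarith [mul_self_nonneg x]
  · have := hP.isMaximal hP0
    exact Ideal.jacobson_eq_self_of_isMaximal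

theorem finite_integralClosure_of_finiteType_int (A : Type u) [CommRing A] [IsDomain A]
    [CharZero A] [Algebra.FiniteType ℤ A] :
    Module.Finite A (integralClosure A (FractionRing A)) := by
  refine Module.Finite.of_forall_maximal fun P hP => ?_
  obtain ⟨p, hp⟩ := CharP.exists (A ⧸ P)
  let _ := Ideal.Quotient.field P
  have hpp : p ≠ 0 := by
    rintro rfl
    have : CharZero (A ⧸ P) := CharP.charP_to_charZero _
    have := isJacobsonRing_int
    have : Module.Finite ℤ (A ⧸ P) := finite_of_finite_type_of_isJacobsonRing ℤ (A ⧸ P)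
    have : Algebra.IsIntegral ℤ (A ⧸ P) := inferInstance
    exact Int.not_isField (isField_of_isIntegral_of_isField (R := ℤ) (S := A ⧸ P)
      (algebraMap ℤ (A ⧸ P)).injective_int (Field.toIsField (A ⧸ P)))
  have : Fact p.Prime := ⟨(CharP.char_is_prime_or_zero (A ⧸ P) p).resolve_right hpp⟩
  have hpP : (p : A) ∈ P := by
    rw [← Ideal.Quotient.eq_zero_iff_mem, map_natCast]
    exact CharP.cast_eq_zero _ _
  have hpI : Ideal.span {(p : A)} ≤ P := (Ideal.span_singleton_le_iff_mem _).2 hpP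
  obtain ⟨n, φ, hφ, hfin⟩ := exists_mvPolynomial_int_finite_quotient A p
    fun h => hP.ne_top (top_le_iff.1 (h ▸ hpI))
  let _ : Algebra (MvPolynomial (ULift.{u} (Fin n)) ℤ) A := φ.toAlgebra
  have : IsScalarTower ℤ (MvPolynomial (ULift.{u} (Fin n)) ℤ) A :=
    IsScalarTower.of_algebraMap_eq' (RingHom.ext_int _ _)
  have : Algebra.FiniteType (MvPolynomial (ULift.{u} (Fin n)) ℤ) A :=
    Algebra.FiniteType.of_restrictScalars_finiteType ℤ _ _
  have : Module.Finite (MvPolynomial (ULift.{u} (Fin n)) ℤ) (A ⧸ Ideal.span {(p : A)}) := by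
    have h : (algebraMap (MvPolynomial (ULift.{u} (Fin n)) ℤ)
      (A ⧸ Ideal.span {(p : A)})).Finite := hfin
    exact RingHom.finite_algebraMap.1 h
  obtain ⟨h, hhP, hh, hx⟩ := exists_pow_mul_isIntegral_of_finite_quotient
    (R := MvPolynomial (ULift.{u} (Fin n)) ℤ) P (Ideal.span {(p : A)}) (by
      rw [Ideal.span_singleton_le_iff_mem, ← map_natCast
        (algebraMap (MvPolynomial (ULift.{u} (Fin n)) ℤ) A)]
      refine Ideal.mem_map_of_mem _ ?_
      rw [Ideal.under, Ideal.mem_comap, map_natCast]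
      exact hpP)
  exact ⟨h, hhP, exists_fg_of_pow_mul_isIntegral HasFiniteClosures.of_charZero hφ
    (fun h0 => hhP (h0 ▸ P.zero_mem)) hh hx⟩

variable {S : Type u} [CommRing S]

lemma LinearlyBoundedClosure.of_finiteType_int [IsDomain S] [IsNoetherianRing S]
    (h : Algebra.FiniteType ℤ S) (bb : Ideal S) : LinearlyBoundedClosure bb := by
  obtain ⟨p, hp⟩ := CharP.exists S
  rcases CharP.char_is_prime_or_zero S p with hpp | rfl
  · have : Fact p.Prime := ⟨hpp⟩
    let _ : Algebra (ZMod p) S := ZMod.algebra S p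
    let _ : Algebra (ULift.{u} (ZMod p)) S := ULift.algebra' (ZMod p) S
    have : IsScalarTower ℤ (ULift.{u} (ZMod p)) S :=
      IsScalarTower.of_algebraMap_eq' (RingHom.ext_int _ _)
    exact LinearlyBoundedClosure.of_fieldBase
      ⟨ULift.{u} (ZMod p), Algebra.FiniteType.of_restrictScalars_finiteType ℤ _ _⟩ bb
  · have : CharZero S := CharP.charP_to_charZero S
    have := finiteType_reesAlgebra bb
    have : @Algebra.FiniteType ℤ (reesAlgebra bb) _ _ (Ring.toIntAlgebra _) := by
      have : IsScalarTower ℤ S (reesAlgebra bb) :=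
        IsScalarTower.of_algebraMap_eq' (RingHom.ext_int _ _)
      exact Algebra.FiniteType.trans (S := S) h ‹_›
    have : CharZero (reesAlgebra bb) :=
      charZero_of_injective_algebraMap (R := S) (FaithfulSMul.algebraMap_injective S _)
    have := finite_integralClosure_of_finiteType_int (reesAlgebra bb)
    exact LinearlyBoundedClosure.of_reesAlgebra

end IntegerBase

section AdicCompleteness

open IsLocalRing

lemma smodEq_pow_smul_top_iff {R : Type*} [CommRing R] {I : Ideal R} {x y : R} {n : ℕ} :
    x ≡ y [SMOD (I ^ n • ⊤ : Submodule R R)] ↔ x - y ∈ I ^ n := by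
  rw [SModEq.sub_mem, smul_eq_mul, Ideal.mul_top]

lemma exists_adic_limit {R : Type*} [CommRing R] (I : Ideal R) [IsPrecomplete I R] (f : ℕ → R)
    (hf : ∀ n, f n - f (n + 1) ∈ I ^ n) : ∃ L : R, ∀ n, f n - L ∈ I ^ n := by
  have key : ∀ m n, m ≤ n → f m - f n ∈ I ^ m := by
    intro m n h
    induction n, h using Nat.le_induction with
    | base => simp
    | succ n h ih =>
      rw [← sub_add_sub_cancel _ (f n)]
      exact add_mem ih (Ideal.pow_le_pow_right h (hf n))
  obtain ⟨L, hL⟩ := IsPrecomplete.prec ‹IsPrecomplete I R› (f := f)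
    fun {m n} h => smodEq_pow_smul_top_iff.2 (key m n h)
  exact ⟨L, fun n => smodEq_pow_smul_top_iff.1 (hL n)⟩

lemma IsAdicComplete.of_forall_limit {R : Type*} [CommRing R] {I : Ideal R}
    (h0 : ∀ x : R, (∀ n, x ∈ I ^ n) → x = 0)
    (h : ∀ f : ℕ → R, (∀ m n, m ≤ n → f m - f n ∈ I ^ m) → ∃ L : R, ∀ n, f n - L ∈ I ^ n) :
    IsAdicComplete I R where
  haus' x hx := h0 x fun n => by simpa using smodEq_pow_smul_top_iff.1 (hx n)
  prec' f hf := by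
    obtain ⟨L, hL⟩ := h f fun m n hmn => smodEq_pow_smul_top_iff.1 (hf hmn)
    exact ⟨L, fun n => smodEq_pow_smul_top_iff.2 (hL n)⟩

lemma eq_zero_of_forall_mem_pow {R : Type*} [CommRing R] {I : Ideal R} [IsHausdorff I R] {x : R}
    (h : ∀ n, x ∈ I ^ n) : x = 0 :=
  IsHausdorff.haus ‹_› x fun n => smodEq_pow_smul_top_iff.2 (by simpa using h n)

lemma Ideal.mem_of_forall_exists_sub_mem_pow {T : Type*} [CommRing T] [IsLocalRing T]
    [IsNoetherianRing T] (J : Ideal T) {x : T}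
    (h : ∀ n, ∃ j ∈ J, x - j ∈ maximalIdeal T ^ n) : x ∈ J := by
  rw [← Ideal.Quotient.eq_zero_iff_mem]
  have : IsHausdorff (maximalIdeal T) (T ⧸ J) := inferInstance
  refine IsHausdorff.haus this _ fun n => ?_
  obtain ⟨j, hj, hx⟩ := h n
  rw [SModEq.zero]
  have h1 : (Ideal.Quotient.mk J x) = (x - j) • (1 : T ⧸ J) := by
    rw [Algebra.smul_def, mul_one, Ideal.Quotient.algebraMap_eq, map_sub,
      Ideal.Quotient.eq_zero_iff_mem.2 hj, sub_zero]
  rw [h1]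
  exact Submodule.smul_mem_smul hx trivial

lemma IsLocalRing.maximalIdeal_map_of_surjective {S A : Type*} [CommRing S] [CommRing A]
    [IsLocalRing S] [IsLocalRing A] (π : S →+* A) (hπ : Function.Surjective π) :
    (maximalIdeal S).map π = maximalIdeal A := by
  have h := Ideal.comap_isMaximal_of_surjective π hπ (K := maximalIdeal A)
  rw [← IsLocalRing.eq_maximalIdeal h, Ideal.map_comap_of_surjective π hπ]

lemma IsAdicComplete.of_surjective_of_isLocalRing {S A : Type*} [CommRing S] [CommRing A]
    [IsLocalRing S] [IsNoetherianRing S] [IsLocalRing A] (π : S →+* A)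
    (hπ : Function.Surjective π) [IsAdicComplete (maximalIdeal S) S] :
    IsAdicComplete (maximalIdeal A) A := by
  have hA : IsNoetherianRing A := isNoetherianRing_of_surjective S A π hπ
  have hmap := IsLocalRing.maximalIdeal_map_of_surjective π hπ
  have hlift : ∀ n (a : A), a ∈ maximalIdeal A ^ n → ∃ s ∈ maximalIdeal S ^ n, π s = a := by
    intro n a ha
    rw [← hmap, ← Ideal.map_pow] at ha
    exact (Ideal.mem_map_iff_of_surjective π hπ).1 ha
  refine IsAdicComplete.of_forall_limit (fun x hx => eq_zero_of_forall_mem_pow hx) fun f hf => ?_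
  choose d hd hdπ using fun n => hlift n _ (hf n (n + 1) (Nat.le_succ n))
  obtain ⟨s0, hs0⟩ := hπ (f 0)
  obtain ⟨L, hL⟩ := exists_adic_limit (maximalIdeal S) (fun n => s0 - ∑ i ∈ Finset.range n, d i)
    fun n => by
      rw [Finset.sum_range_succ]
      convert hd n using 1
      ring
  refine ⟨π L, fun n => ?_⟩
  have : f n = π (s0 - ∑ i ∈ Finset.range n, d i) := by
    clear hL
    induction n with
    | zero => simp [hs0]
    | succ n ih =>
      rw [Finset.sum_range_succ, ← sub_sub, map_sub, ← ih, hdπ]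
      ring
  rw [this, ← map_sub, ← hmap, ← Ideal.map_pow]
  exact Ideal.mem_map_of_mem _ (hL n)

namespace PowerSeries

variable {S : Type*} [CommRing S] [IsLocalRing S]

lemma mem_maximalIdeal_iff {f : PowerSeries S} :
    f ∈ maximalIdeal (PowerSeries S) ↔ constantCoeff f ∈ maximalIdeal S := by
  simp only [mem_maximalIdeal, mem_nonunits_iff, PowerSeries.isUnit_iff_constantCoeff]

lemma mem_maximalIdeal_pow_iff {f : PowerSeries S} {j : ℕ} :
    f ∈ maximalIdeal (PowerSeries S) ^ j ↔ ∀ n, coeff n f ∈ maximalIdeal S ^ (j - n) := by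
  constructor
  · intro hf
    induction j generalizing f with
    | zero => simp
    | succ j ih =>
      rw [pow_succ] at hf
      refine Submodule.mul_induction_on hf (fun g hg x hx n => ?_) fun x y hx hy n => ?_
      · rw [coeff_mul]
        refine sum_mem fun ⟨a, b⟩ hab => ?_
        replace hab := Finset.HasAntidiagonal.mem_antidiagonal.1 hab
        simp only at hab ⊢
        rcases Nat.eq_zero_or_pos b with rfl | hb
        · have h1 := Ideal.mul_mem_mul (ih hg a)
            (mem_maximalIdeal_iff.1 hx)
          rw [← pow_succ] at h1
          simpa using Ideal.pow_le_pow_right (by omega) h1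
        · exact Ideal.mul_mem_right _ _ (Ideal.pow_le_pow_right (by omega) (ih hg a))
      · rw [map_add]
        exact add_mem (hx n) (hy n)
  · intro h
    rw [eq_X_pow_mul_shift_add_trunc j f]
    have hX : (X : PowerSeries S) ∈ maximalIdeal (PowerSeries S) := by
      rw [mem_maximalIdeal_iff]; simp
    refine add_mem (Ideal.mul_mem_right _ _ (Ideal.pow_mem_pow hX j)) ?_
    have hC : (maximalIdeal S).map (C (R := S)) ≤ maximalIdeal (PowerSeries S) :=
      Ideal.map_le_iff_le_comap.2 fun a ha => by
        rw [Ideal.mem_comap, mem_maximalIdeal_iff]; simpa using ha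
    have : ((trunc j f : Polynomial S) : PowerSeries S) =
        ∑ n ∈ Finset.range j, C (coeff n f) * X ^ n := by
      rw [← Polynomial.eval₂_C_X_eq_coe, eval₂_trunc_eq_sum_range]
    rw [this]
    refine sum_mem fun n hn => ?_
    rw [Finset.mem_range] at hn
    have h1 : C (coeff n f) ∈ maximalIdeal (PowerSeries S) ^ (j - n) := by
      refine Ideal.pow_right_mono hC _ ?_
      rw [← Ideal.map_pow]
      exact Ideal.mem_map_of_mem _ (h n)
    have h2 := Ideal.mul_mem_mul h1 (Ideal.pow_mem_pow hX n)
    rwa [← pow_add, Nat.sub_add_cancel hn.le] at h2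

instance isAdicComplete_maximalIdeal [IsAdicComplete (maximalIdeal S) S] :
    IsAdicComplete (maximalIdeal (PowerSeries S)) (PowerSeries S) := by
  refine IsAdicComplete.of_forall_limit (fun f hf => ?_) fun f hf => ?_
  · ext n
    refine eq_zero_of_forall_mem_pow (I := maximalIdeal S) fun k => ?_
    simpa using mem_maximalIdeal_pow_iff.1 (hf (k + n)) n
  · have h : ∀ n, ∃ L, ∀ i, coeff n (f (i + n)) - L ∈ maximalIdeal S ^ i := fun n =>
      exists_adic_limit (maximalIdeal S) (fun i => coeff n (f (i + n))) fun i => by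
        have := mem_maximalIdeal_pow_iff.1 (hf (i + n) (i + 1 + n) (by omega)) n
        simpa using this
    choose L hL using h
    refine ⟨PowerSeries.mk L, fun j => mem_maximalIdeal_pow_iff.2 fun n => ?_⟩
    rw [map_sub, coeff_mk]
    rcases le_total n j with hnj | hnj
    · have := hL n (j - n)
      rwa [Nat.sub_add_cancel hnj] at this
    · simp [Nat.sub_eq_zero_of_le hnj]

lemma exists_extension {R T : Type*} [CommRing R] [CommRing T] (M : Ideal T) [IsAdicComplete M T]
    (φ : R →+* T) {z : T} (hz : z ∈ M) :
    ∃ ψ : PowerSeries R →+* T, (∀ r, ψ (C r) = φ r) ∧ ψ X = z ∧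
      ∀ f N, ψ f - ∑ n ∈ Finset.range N, φ (coeff n f) * z ^ n ∈ M ^ N := by
  have hzpow : ∀ N, (Ideal.Quotient.mk (M ^ N) z) ^ N = 0 := fun N => by
    rw [← map_pow, Ideal.Quotient.eq_zero_iff_mem]
    exact Ideal.pow_mem_pow hz N
  have hcoe : ∀ N (p : Polynomial R), (∀ n < N, p.coeff n = 0) →
      Ideal.Quotient.mk (M ^ N) (p.eval₂ φ z) = 0 := by
    intro N p hp
    obtain ⟨q, rfl⟩ := Polynomial.X_pow_dvd_iff.2 hp
    rw [Polynomial.eval₂_mul, map_mul, Polynomial.eval₂_X_pow, map_pow, hzpow, zero_mul]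
  have heq : ∀ N (p q : Polynomial R), (∀ n < N, p.coeff n = q.coeff n) →
      Ideal.Quotient.mk (M ^ N) (p.eval₂ φ z) = Ideal.Quotient.mk (M ^ N) (q.eval₂ φ z) := by
    intro N p q h
    rw [← sub_eq_zero, ← map_sub, ← Polynomial.eval₂_sub]
    exact hcoe N _ fun n hn => by rw [Polynomial.coeff_sub, h n hn, sub_self]
  let F : (N : ℕ) → PowerSeries R →+* T ⧸ M ^ N := fun N =>
    { toFun := fun f => Ideal.Quotient.mk _ ((trunc N f).eval₂ φ z)
      map_one' := by
        rw [heq N _ 1 (fun n hn => by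
          rw [coeff_trunc, if_pos hn, coeff_one, Polynomial.coeff_one])]
        simp
      map_mul' := fun f g => by
        rw [← map_mul, ← Polynomial.eval₂_mul]
        refine heq N _ _ fun n hn => ?_
        rw [coeff_trunc, if_pos hn, coeff_mul_eq_coeff_trunc_mul_trunc f g hn,
          ← Polynomial.coe_mul, Polynomial.coeff_coe]
      map_zero' := by simp
      map_add' := fun f g => by rw [map_add, Polynomial.eval₂_add, map_add] }
  have hF : ∀ {m n : ℕ} (hle : m ≤ n), (Ideal.Quotient.factorPow M hle).comp (F n) = F m := by
    intro m n hle
    ext f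
    simp only [RingHom.comp_apply, F, RingHom.coe_mk, MonoidHom.coe_mk, OneHom.coe_mk,
      Ideal.Quotient.factor_mk]
    refine heq m _ _ fun i hi => ?_
    rw [coeff_trunc, coeff_trunc, if_pos hi, if_pos (hi.trans_le hle)]
  let ψ := IsAdicComplete.liftRingHom M F hF
  have hψ : ∀ f N, Ideal.Quotient.mk (M ^ N) (ψ f) =
      Ideal.Quotient.mk (M ^ N) ((trunc N f).eval₂ φ z) := fun f N =>
    IsAdicComplete.mk_liftRingHom M F hF N f
  have heqz : ∀ x y : T, (∀ N, Ideal.Quotient.mk (M ^ N) x = Ideal.Quotient.mk (M ^ N) y) →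
      x = y := fun x y h => sub_eq_zero.1 (eq_zero_of_forall_mem_pow (I := M) fun n =>
        Ideal.Quotient.eq.1 (h n))
  refine ⟨ψ, fun r => heqz _ _ fun N => ?_, heqz _ _ fun N => ?_, fun f N => ?_⟩
  · rw [hψ, heq N _ (Polynomial.C r) fun n hn => by
      rw [coeff_trunc, if_pos hn, coeff_C, Polynomial.coeff_C]]
    simp
  · rw [hψ, heq N _ Polynomial.X fun n hn => by
      rw [coeff_trunc, if_pos hn, coeff_X, Polynomial.coeff_X]; simp [eq_comm]]
    simp
  · rw [← eval₂_trunc_eq_sum_range]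
    exact Ideal.Quotient.eq.1 (hψ f N)

end PowerSeries

end AdicCompleteness

namespace PowerSeries

open IsLocalRing

lemma exists_complete_cover_reesAlgebra {S : Type u} [CommRing S] [IsLocalRing S]
    [IsNoetherianRing S] [IsAdicComplete (maximalIdeal S) S] (bb : Ideal S) (s : Finset S)
    (hs : ∀ b ∈ s, b ∈ bb) :
    ∃ (S' : Type u) (_ : CommRing S') (_ : IsLocalRing S') (_ : IsNoetherianRing S')
      (_ : IsAdicComplete (maximalIdeal S') S') (Θ : S' →+* PowerSeries S),
      (∀ f n, coeff n (Θ f) ∈ bb ^ n) ∧ (∀ r, C r ∈ Θ.range) ∧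
        ∀ b ∈ s, C b * X ∈ Θ.range := by
  classical
  induction s using Finset.induction_on with
  | empty =>
    refine ⟨S, inferInstance, inferInstance, inferInstance, inferInstance, C, fun f n => ?_,
      fun r => ⟨r, rfl⟩, by simp⟩
    rw [coeff_C]
    split_ifs with h
    · simp [h]
    · exact zero_mem _
  | insert b s hb ih =>
    obtain ⟨S', _, _, _, _, Θ, h1, h2, h3⟩ := ih fun x hx => hs x (Finset.mem_insert_of_mem hx)
    obtain ⟨ψ, hC, hX, hψ⟩ := PowerSeries.exists_extension (Ideal.span {(X : PowerSeries S)}) Θ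
      (z := C b * X) (Ideal.mul_mem_left _ _ (Ideal.mem_span_singleton_self _))
    have hle : ∀ r ∈ Θ.range, r ∈ ψ.range := by
      rintro _ ⟨r, rfl⟩
      exact ⟨C r, hC r⟩
    refine ⟨PowerSeries S', inferInstance, inferInstance, inferInstance, inferInstance, ψ,
      fun f n => ?_, fun r => hle _ (h2 r), fun x hx => ?_⟩
    · have h4 := hψ f (n + 1)
      rw [Ideal.span_singleton_pow, Ideal.mem_span_singleton, X_pow_dvd_iff] at h4
      have h5 := h4 n (Nat.lt_succ_self n)
      rw [map_sub, sub_eq_zero] at h5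
      rw [h5, map_sum]
      refine sum_mem fun i _ => ?_
      rw [mul_pow, ← map_pow, ← mul_assoc, coeff_mul_X_pow']
      split_ifs with hin
      · rw [coeff_mul_C]
        have := Ideal.mul_mem_mul (h1 (coeff i f) (n - i))
          (Ideal.pow_mem_pow (hs b (Finset.mem_insert_self b s)) i)
        rwa [← pow_add, Nat.sub_add_cancel hin] at this
      · exact zero_mem _
    · rcases Finset.mem_insert.1 hx with rfl | hx
      · exact ⟨X, hX⟩
      · exact hle _ (h3 x hx)

lemma _root_.LinearlyBoundedClosure.of_forall_complete_finite {S : Type u} [CommRing S] [IsDomain S]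
    [IsLocalRing S] [IsNoetherianRing S] [IsAdicComplete (maximalIdeal S) S] (bb : Ideal S)
    (h : ∀ (T : Type u) [CommRing T] [IsDomain T] [IsLocalRing T] [IsNoetherianRing T]
      [IsAdicComplete (maximalIdeal T) T], Module.Finite T (integralClosure T (FractionRing T))) :
    LinearlyBoundedClosure bb := by
  obtain ⟨s, hs⟩ := IsNoetherian.noetherian bb
  obtain ⟨S', _, _, _, _, Θ, h1, h2, h3⟩ := exists_complete_cover_reesAlgebra bb s
    fun b hb => hs ▸ Ideal.subset_span hb
  have hbb : ∀ b ∈ bb, C b * X ∈ Θ.range := by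
    intro b hb
    rw [← hs] at hb
    refine Submodule.span_induction (fun x hx => h3 x hx) ?_ (fun x y _ _ hx hy => ?_)
      (fun a x _ hx => ?_) hb
    · simp
    · rw [map_add, add_mul]
      exact add_mem hx hy
    · rw [smul_eq_mul, map_mul, mul_assoc]
      exact mul_mem (h2 a) hx
  have hmono : ∀ n, ∀ r ∈ bb ^ n, monomial n r ∈ Θ.range := by
    intro n
    induction n with
    | zero =>
      intro r _
      rw [monomial_zero_eq_C_apply]
      exact h2 r
    | succ n ih =>
      intro r hr
      rw [pow_succ] at hr
      refine Submodule.mul_induction_on hr (fun x hx b hb => ?_) fun x y hx hy => ?_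
      · have : monomial (n + 1) (x * b) = monomial n x * (C b * X) := by
          rw [← monomial_zero_eq_C_apply, X_eq, monomial_mul_monomial, monomial_mul_monomial]
          simp
        rw [this]
        exact mul_mem (ih x hx) (hbb b hb)
      · rw [map_add]
        exact add_mem hx hy
  have hinj := RingHom.kerLift_injective Θ
  have hdom : IsDomain (S' ⧸ RingHom.ker Θ) := hinj.isDomain _
  have hsurj := Ideal.Quotient.mk_surjective (I := RingHom.ker Θ)
  have hloc : IsLocalRing (S' ⧸ RingHom.ker Θ) := IsLocalRing.of_surjective' _ hsurj
  have hcomp := IsAdicComplete.of_surjective_of_isLocalRing _ hsurj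
  have hfin := h (S' ⧸ RingHom.ker Θ)
  refine LinearlyBoundedClosure.of_finite_integralClosure (RingHom.kerLift Θ) hinj
    (fun f n => ?_) fun n r hr => ?_
  · obtain ⟨f, rfl⟩ := hsurj f
    exact h1 f n
  · obtain ⟨f, hf⟩ := hmono n r hr
    exact ⟨Ideal.Quotient.mk _ f, hf⟩

end PowerSeries

section SpansModulo

open IsLocalRing

/-- `T ⧸ J` is generated by finitely many elements as a module over `R` (through `φ`). -/
def SpansModulo {R T : Type*} [CommRing R] [CommRing T] (φ : R →+* T) (J : Ideal T) : Prop :=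
  ∃ (k : ℕ) (e : Fin k → T), ∀ t, ∃ c : Fin k → R, t - ∑ i, φ (c i) * e i ∈ J

lemma SpansModulo.mono {R T : Type*} [CommRing R] [CommRing T] {φ : R →+* T} {J J' : Ideal T}
    (h : SpansModulo φ J) (hJ : J ≤ J') : SpansModulo φ J' := by
  obtain ⟨k, e, h⟩ := h
  exact ⟨k, e, fun t => (h t).imp fun c hc => hJ hc⟩

lemma SpansModulo.finite {R T : Type*} [CommRing R] [CommRing T] {φ : R →+* T}
    (h : SpansModulo φ ⊥) : φ.Finite := by
  obtain ⟨k, e, h⟩ := h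
  algebraize [φ]
  classical
  refine ⟨⟨Finset.univ.image e, ?_⟩⟩
  refine eq_top_iff.2 fun t _ => ?_
  obtain ⟨c, hc⟩ := h t
  rw [Ideal.mem_bot, sub_eq_zero] at hc
  rw [hc]
  refine sum_mem fun i _ => ?_
  exact Submodule.smul_mem _ (c i) (Submodule.subset_span (by simp))

lemma SpansModulo.of_series_of_closed {R R' T : Type*} [CommRing R] [CommRing R'] [CommRing T]
    (M : Ideal T) {φ : R →+* T} {ψ : R' →+* T} {z : T}
    (hz : z ∈ M)
    (hser : ∀ v : ℕ → R, ∃ w : R', ∀ N,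
      ψ w - ∑ n ∈ Finset.range N, φ (v n) * z ^ n ∈ M ^ N)
    {J : Ideal T} (hclosed : ∀ x, (∀ N, ∃ j ∈ J, x - j ∈ M ^ N) → x ∈ J)
    (h : SpansModulo φ (J ⊔ Ideal.span {z})) : SpansModulo ψ J := by
  obtain ⟨k, e, h⟩ := h
  refine ⟨k, e, fun t => ?_⟩
  have hstep : ∀ t, ∃ (c : Fin k → R) (t' : T), t - ∑ i, φ (c i) * e i - z * t' ∈ J := by
    intro t
    obtain ⟨c, hc⟩ := h t
    obtain ⟨j, hj, y, hy, hjy⟩ := Submodule.mem_sup.1 hc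
    obtain ⟨t', rfl⟩ := Ideal.mem_span_singleton'.1 hy
    refine ⟨c, t', ?_⟩
    rw [← hjy]
    simpa [mul_comm z] using hj
  choose c t' ht' using hstep
  let τ : ℕ → T := fun n => t'^[n] t
  have hτ : ∀ n, τ (n + 1) = t' (τ n) := fun n => Function.iterate_succ_apply' _ _ _
  have hJ : ∀ N, t - ∑ n ∈ Finset.range N, (∑ i, φ (c (τ n) i) * e i) * z ^ n -
      z ^ N * τ N ∈ J := by
    intro N
    induction N with
    | zero => simp [τ]
    | succ N ih =>
      have h1 := add_mem ih (Ideal.mul_mem_left J (z ^ N) (ht' (τ N)))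
      rw [← hτ] at h1
      rw [Finset.sum_range_succ]
      convert h1 using 1
      ring
  choose w hw using fun i : Fin k => hser fun n => c (τ n) i
  refine ⟨w, hclosed _ fun N => ⟨_, hJ N, ?_⟩⟩
  have h2 : (∑ n ∈ Finset.range N, (∑ i, φ (c (τ n) i) * e i) * z ^ n) =
      ∑ i, (∑ n ∈ Finset.range N, φ (c (τ n) i) * z ^ n) * e i := by
    simp_rw [Finset.sum_mul]
    rw [Finset.sum_comm]
    exact Finset.sum_congr rfl fun i _ => Finset.sum_congr rfl fun n _ => by ring
  have h3 : t - ∑ i, ψ (w i) * e i - (t - ∑ n ∈ Finset.range N,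
      (∑ i, φ (c (τ n) i) * e i) * z ^ n - z ^ N * τ N) = z ^ N * τ N -
      ∑ i, (ψ (w i) - ∑ n ∈ Finset.range N, φ (c (τ n) i) * z ^ n) * e i := by
    rw [h2]
    simp_rw [sub_mul]
    rw [Finset.sum_sub_distrib]
    ring
  rw [h3]
  exact sub_mem (Ideal.mul_mem_right _ _ (Ideal.pow_mem_pow hz N))
    (sum_mem fun i _ => Ideal.mul_mem_right _ _ (hw i N))

lemma SpansModulo.of_series {R R' T : Type*} [CommRing R] [CommRing R'] [CommRing T]
    [IsLocalRing T] [IsNoetherianRing T] {φ : R →+* T} {ψ : R' →+* T} {z : T}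
    (hz : z ∈ maximalIdeal T)
    (hser : ∀ v : ℕ → R, ∃ w : R', ∀ N,
      ψ w - ∑ n ∈ Finset.range N, φ (v n) * z ^ n ∈ maximalIdeal T ^ N)
    {J : Ideal T} (h : SpansModulo φ (J ⊔ Ideal.span {z})) : SpansModulo ψ J :=
  h.of_series_of_closed (maximalIdeal T) hz hser fun _ => J.mem_of_forall_exists_sub_mem_pow

lemma SpansModulo.maximalIdeal_pow {V T : Type*} [CommRing V] [CommRing T]
    [IsLocalRing T] [IsNoetherianRing T] {φ : V →+* T}
    (h : ∀ t, ∃ v, t - φ v ∈ maximalIdeal T) (n : ℕ) :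
    SpansModulo φ (maximalIdeal T ^ n) := by
  induction n with
  | zero => exact ⟨0, Fin.elim0, fun t => ⟨Fin.elim0, by simp⟩⟩
  | succ n ih =>
    obtain ⟨k, e, he⟩ := ih
    obtain ⟨l, g, hg⟩ := Submodule.fg_iff_exists_fin_generating_family.1
      (IsNoetherian.noetherian (maximalIdeal T ^ n))
    refine ⟨k + l, Fin.append e g, fun t => ?_⟩
    obtain ⟨c, hc⟩ := he t
    have hc' := hc
    rw [← hg, Submodule.mem_span_range_iff_exists_fun] at hc'
    obtain ⟨a, ha⟩ := hc'
    choose v hv using fun i => h (a i)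
    refine ⟨Fin.append c v, ?_⟩
    rw [Fin.sum_univ_add]
    simp only [Fin.append_left, Fin.append_right]
    rw [← sub_sub, ← ha, ← Finset.sum_sub_distrib]
    refine sum_mem fun i _ => ?_
    rw [smul_eq_mul, ← sub_mul, pow_succ']
    exact Ideal.mul_mem_mul (hv i) (hg ▸ Submodule.subset_span ⟨i, rfl⟩)

end SpansModulo

section PBasis

open IsLocalRing

/-- Elements of a subfield `F` containing `c ^ p` are linearly independent from the lower powers
of an element `c ∉ F`, in characteristic `p`. -/
lemma Subfield.coeff_eq_zero_of_sum_pow_eq_zero {k : Type*} [Field k] {p : ℕ} [Fact p.Prime]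
    [CharP k p] (F : Subfield k) {c : k} (hc : c ∉ F) (hcp : c ^ p ∈ F) (a : ℕ → k)
    (ha : ∀ j, a j ∈ F) (h : ∑ j ∈ Finset.range p, a j * c ^ j = 0) : ∀ j < p, a j = 0 := by
  have hp : p.Prime := Fact.out
  let b : F := ⟨c ^ p, hcp⟩
  have hirr : Irreducible (Polynomial.X ^ p - Polynomial.C b) := by
    refine X_pow_sub_C_irreducible_of_prime hp fun d hd => hc ?_
    have h1 : (d : k) ^ p = c ^ p := congrArg Subtype.val hd
    have h2 : (d : k) = c := frobenius_inj k p h1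
    exact h2 ▸ d.2
  have hmin : minpoly F c = Polynomial.X ^ p - Polynomial.C b :=
    (minpoly.eq_of_irreducible_of_monic hirr (by simp [b]; exact sub_self _)
      (Polynomial.monic_X_pow_sub_C b hp.ne_zero)).symm
  let q : Polynomial F :=
    ∑ j ∈ Finset.range p, Polynomial.C (⟨a j, ha j⟩ : F) * Polynomial.X ^ j
  have hq : q = 0 := by
    refine Polynomial.eq_zero_of_dvd_of_degree_lt (p := minpoly F c) (minpoly.dvd _ _ ?_) ?_
    · rw [← h]
      simp only [q, map_sum, map_mul, map_pow, Polynomial.aeval_C, Polynomial.aeval_X]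
      rfl
    · rw [hmin, Polynomial.degree_X_pow_sub_C hp.pos]
      refine (Polynomial.degree_sum_le _ _).trans_lt ?_
      rw [Finset.sup_lt_iff (by exact WithBot.bot_lt_coe p)]
      intro j hj
      exact (Polynomial.degree_C_mul_X_pow_le _ _).trans_lt
        (by exact_mod_cast Finset.mem_range.1 hj)
  intro j hj
  have h3 : q.coeff j = 0 := by rw [hq, Polynomial.coeff_zero]
  simp only [q, Polynomial.finsetSum_coeff, Polynomial.coeff_C_mul, Polynomial.coeff_X_pow,
    mul_ite, mul_one, mul_zero, Finset.sum_ite_eq, Finset.mem_range, if_pos hj] at h3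
  exact congrArg Subtype.val h3

lemma Subring.exists_sum_pow_of_mem_closure_insert {T : Type*} [CommRing T] {p : ℕ} (hp : 0 < p)
    (E : Subring T) {l : T} (hl : l ^ p ∈ E) {x : T} (hx : x ∈ Subring.closure (insert l E)) :
    ∃ y : ℕ → T, (∀ j, y j ∈ E) ∧ x = ∑ j ∈ Finset.range p, y j * l ^ j := by
  nontriviality T
  have h1 : Subring.closure (insert l (E : Set T)) ≤
      (Polynomial.aeval (R := E) l).toRingHom.range := by
    rw [Subring.closure_le]
    intro z hz
    rcases hz with rfl | hz
    · exact ⟨Polynomial.X, by simp⟩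
    · exact ⟨Polynomial.C ⟨z, hz⟩, by simp; rfl⟩
  obtain ⟨q, rfl⟩ := h1 hx
  let g : Polynomial E := Polynomial.X ^ p - Polynomial.C ⟨l ^ p, hl⟩
  have hg : g.Monic := Polynomial.monic_X_pow_sub_C _ hp.ne'
  have hgl : Polynomial.aeval l g = 0 := by
    simp [g]
    exact sub_self _
  refine ⟨fun j => ((q %ₘ g).coeff j : E), fun j => Subtype.property _, ?_⟩
  have hdeg : (q %ₘ g).natDegree < p := by
    have h2 : g.natDegree = p := Polynomial.natDegree_X_pow_sub_C
    rw [← h2]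
    exact Polynomial.natDegree_modByMonic_lt q hg (by
      intro h3
      rw [h3, Polynomial.natDegree_one] at h2
      omega)
  have h4 : Polynomial.aeval l q = Polynomial.aeval l (q %ₘ g) := by
    conv_lhs => rw [← Polynomial.modByMonic_add_div q g]
    rw [map_add, map_mul, hgl, zero_mul, add_zero]
  change Polynomial.aeval l q = _
  rw [h4, Polynomial.aeval_eq_sum_range' hdeg]
  rfl

lemma exists_pBasis (k : Type*) [Field k] (p : ℕ) : ∃ (_ : LinearOrder k) (B : Set k),
    (∀ b ∈ B, b ∉ Subfield.closure (Set.range (fun x : k => x ^ p) ∪ {c | c ∈ B ∧ c < b})) ∧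
    Subfield.closure (Set.range (fun x : k => x ^ p) ∪ B) = ⊤ := by
  obtain ⟨_, _⟩ := exists_wellFoundedLT k
  let B : Set k := {b | b ∉ Subfield.closure (Set.range (fun x : k => x ^ p) ∪ {c | c < b})}
  refine ⟨inferInstance, B, fun b hb h => hb (Subfield.closure_mono (by
    gcongr; exact fun hc => hc.2) h), eq_top_iff.2 fun x _ => ?_⟩
  induction x using WellFoundedLT.induction with
  | ind x ih =>
  by_cases hx : x ∈ B
  · exact Subfield.subset_closure (Or.inr hx)
  · have hx' : x ∈ Subfield.closure (Set.range (fun x : k => x ^ p) ∪ {c | c < x}) := by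
      by_contra h
      exact hx h
    refine (Subfield.closure_le.2 ?_) hx'
    rintro y (hy | hy)
    · exact Subfield.subset_closure (Or.inl hy)
    · exact ih y hy trivial

lemma Subring.mem_of_forall_pow_mem {k : Type*} [Field k] {p : ℕ} (hp : 0 < p) {B : Set k}
    (hB : Subfield.closure (Set.range (fun x : k => x ^ p) ∪ B) = ⊤) (A : Subring k)
    (hA : ∀ x, x ^ p ∈ A) (hBA : B ⊆ A) (x : k) : x ∈ A := by
  let A' : Subfield k :=
    { A with
      inv_mem' := fun y hy => by
        rcases eq_or_ne y 0 with rfl | h0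
        · simp
        have : y⁻¹ = y ^ (p - 1) * (y⁻¹) ^ p := by
          obtain ⟨q, rfl⟩ := Nat.exists_eq_add_of_le' hp
          rw [Nat.add_sub_cancel, pow_succ, ← mul_assoc, ← mul_pow, mul_inv_cancel₀ h0, one_pow,
            one_mul]
        rw [this]
        exact A.mul_mem (A.pow_mem hy _) (hA _) }
  have h : Subfield.closure (Set.range (fun x : k => x ^ p) ∪ B) ≤ A' := by
    rw [Subfield.closure_le]
    rintro y (⟨y, rfl⟩ | hy)
    · exact hA y
    · exact hBA hy
  exact h (hB ▸ trivial)

lemma mem_of_mem_closure_pBasis_of_residue_eq_zero {T k : Type*} [CommRing T] [Field k]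
    [LinearOrder k] {p : ℕ} [Fact p.Prime] [CharP k p] (π : T →+* k) (lift : k → T)
    (hlift : ∀ c, π (lift c) = c) (B : Set k)
    (hB : ∀ b ∈ B, b ∉ Subfield.closure (Set.range (fun x : k => x ^ p) ∪ {c | c ∈ B ∧ c < b}))
    (U E : Subring T) (Q : AddSubgroup T) (hBU : ∀ b ∈ B, lift b ∈ U)
    (hQ : ∀ u ∈ U, ∀ q ∈ Q, u * q ∈ Q) (hE : ∀ u ∈ U, u ^ p ∈ E)
    (hEk : ∀ x ∈ E, π x ∈ Set.range (fun x : k => x ^ p))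
    (h0 : ∀ x ∈ E, π x = 0 → x ∈ Q) (s : Finset k) (hs : (s : Set k) ⊆ B) :
    ∀ x ∈ Subring.closure ((E : Set T) ∪ lift '' s), π x = 0 → x ∈ Q := by
  have hp : p.Prime := Fact.out
  induction s using Finset.induction_on_max with
  | empty =>
    intro x hx
    rw [Finset.coe_empty, Set.image_empty, Set.union_empty, Subring.closure_eq] at hx
    exact h0 x hx
  | insert b s hb ih =>
    have hbB : b ∈ B := hs (by simp)
    have hsB : (s : Set k) ⊆ B := fun c hc => hs (by simp [Finset.mem_coe.1 hc])
    intro x hx hx0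
    let A := Subring.closure ((E : Set T) ∪ lift '' s)
    have hxA : x ∈ Subring.closure (insert (lift b) (A : Set T)) := by
      refine Subring.closure_mono ?_ hx
      rintro y (hy | ⟨c, hc, rfl⟩)
      · exact Or.inr (Subring.subset_closure (Or.inl hy))
      · rcases Finset.mem_insert.1 (Finset.mem_coe.1 hc) with rfl | hc
        · exact Or.inl rfl
        · exact Or.inr (Subring.subset_closure (Or.inr ⟨c, hc, rfl⟩))
    obtain ⟨y, hy, rfl⟩ := Subring.exists_sum_pow_of_mem_closure_insert hp.pos A
      (Subring.subset_closure (Or.inl (hE _ (hBU b hbB)))) hxA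
    let F := Subfield.closure (Set.range (fun x : k => x ^ p) ∪ {c | c ∈ B ∧ c < b})
    have hAF : A ≤ F.toSubring.comap π := by
      rw [Subring.closure_le]
      rintro z (hz | ⟨c, hc, rfl⟩)
      · exact Subfield.subset_closure (Or.inl (hEk z hz))
      · change π (lift c) ∈ F
        rw [hlift]
        exact Subfield.subset_closure (Or.inr ⟨hsB hc, hb c hc⟩)
    have hzero := Subfield.coeff_eq_zero_of_sum_pow_eq_zero (p := p) F (hB b hbB)
      (Subfield.subset_closure (Or.inl ⟨b, rfl⟩)) (fun j => π (y j)) (fun j => hAF (hy j)) (by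
        rw [← hx0, map_sum]
        simp only [map_mul, map_pow, hlift])
    refine sum_mem fun j hj => ?_
    rw [mul_comm]
    exact hQ _ (pow_mem (hBU b hbB) j) _ (ih hsB _ (hy j) (hzero j (Finset.mem_range.1 hj)))

end PBasis

section CohenChain

/-- A descending chain of subrings, generated by `p`-th powers, multiples of `p`, a set `L` and
powers of the ideal `M`, whose intersection is a coefficient ring of a complete local ring. -/
def cohenChain {T : Type*} [CommRing T] (M : Ideal T) (p : ℕ) (L : Set T) : ℕ → Subring T
  | 0 => ⊤
  | n + 1 => Subring.closure (((fun x => x ^ p) '' cohenChain M p L n ∪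
      (fun x => (p : T) * x) '' cohenChain M p L n) ∪ (M ^ (n + 2) : Ideal T) ∪ L)

variable {T : Type*} [CommRing T] {M : Ideal T} {p : ℕ} {L : Set T}

lemma pow_mem_cohenChain_succ {n : ℕ} {x : T} (hx : x ∈ cohenChain M p L n) :
    x ^ p ∈ cohenChain M p L (n + 1) :=
  Subring.subset_closure (Or.inl (Or.inl (Or.inl ⟨x, hx, rfl⟩)))

lemma mul_mem_cohenChain_succ {n : ℕ} {x : T} (hx : x ∈ cohenChain M p L n) :
    (p : T) * x ∈ cohenChain M p L (n + 1) :=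
  Subring.subset_closure (Or.inl (Or.inl (Or.inr ⟨x, hx, rfl⟩)))

lemma mem_cohenChain_of_mem_pow {n : ℕ} {x : T} (hx : x ∈ M ^ (n + 1)) :
    x ∈ cohenChain M p L n := by
  cases n with
  | zero => trivial
  | succ n => exact Subring.subset_closure (Or.inl (Or.inr hx))

lemma subset_cohenChain (n : ℕ) : L ⊆ cohenChain M p L n := by
  cases n with
  | zero => exact fun _ _ => trivial
  | succ n => exact fun x hx => Subring.subset_closure (Or.inr hx)

lemma cohenChain_succ_le (n : ℕ) : cohenChain M p L (n + 1) ≤ cohenChain M p L n := by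
  induction n with
  | zero => exact fun _ _ => trivial
  | succ n ih =>
    refine Subring.closure_le.2 ?_
    rintro _ (((⟨x, hx, rfl⟩ | ⟨x, hx, rfl⟩) | hx) | hx)
    · exact pow_mem_cohenChain_succ (ih hx)
    · exact mul_mem_cohenChain_succ (ih hx)
    · exact mem_cohenChain_of_mem_pow (Ideal.pow_le_pow_right (Nat.le_succ _) hx)
    · exact subset_cohenChain _ hx

lemma cohenChain_antitone : Antitone (cohenChain M p L) := antitone_nat_of_succ_le cohenChain_succ_le

lemma mem_cohenChain_of_mul_eq_one (hp : 0 < p) {n : ℕ} {x y : T} (hx : x ∈ cohenChain M p L n)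
    (hxy : x * y = 1) : y ∈ cohenChain M p L n := by
  induction n with
  | zero => trivial
  | succ n ih =>
    have hy := pow_mem_cohenChain_succ (ih (cohenChain_succ_le n hx))
    have : y = x ^ (p - 1) * y ^ p := by
      obtain ⟨q, rfl⟩ := Nat.exists_eq_add_of_le' hp
      rw [Nat.add_sub_cancel, pow_succ, ← mul_assoc, ← mul_pow, hxy, one_pow, one_mul]
    rw [this]
    exact mul_mem (pow_mem hx _) hy

lemma exists_mem_cohenChain_residue_eq {k : Type*} [Field k] (hp : 0 < p) (π : T →+* k)
    (hπ : Function.Surjective π)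
    (hL : Subfield.closure (Set.range (fun x : k => x ^ p) ∪ π '' L) = ⊤) (n : ℕ) (c : k) :
    ∃ x ∈ cohenChain M p L n, π x = c := by
  induction n generalizing c with
  | zero =>
    obtain ⟨x, rfl⟩ := hπ c
    exact ⟨x, trivial, rfl⟩
  | succ n ih =>
    refine Subring.mem_of_forall_pow_mem hp hL ((cohenChain M p L (n + 1)).map π) (fun x => ?_)
      ?_ c
    · obtain ⟨y, hy, rfl⟩ := ih x
      exact ⟨y ^ p, pow_mem_cohenChain_succ hy, map_pow π y p⟩
    · rintro _ ⟨y, hy, rfl⟩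
      exact ⟨y, subset_cohenChain _ hy, rfl⟩

lemma exists_mem_cohenChain_succ_sub_mem {k : Type*} [Field k] (hp : p.Prime) (π : T →+* k)
    (hπ : Function.Surjective π) (hker : ∀ x, π x = 0 → x ∈ M) (hpM : (p : T) ∈ M)
    (hL : Subfield.closure (Set.range (fun x : k => x ^ p) ∪ π '' L) = ⊤) (n : ℕ) {x : T}
    (hx : x ∈ cohenChain M p L n) : ∃ y ∈ cohenChain M p L (n + 1), x - y ∈ M ^ (n + 1) := by
  induction n generalizing x with
  | zero =>
    obtain ⟨y, hy, hyx⟩ := exists_mem_cohenChain_residue_eq (M := M) hp.pos π hπ hL 1 (π x)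
    exact ⟨y, hy, by simpa using hker (x - y) (by rw [map_sub, hyx, sub_self])⟩
  | succ n ih =>
    let q := Ideal.Quotient.mk (M ^ (n + 2))
    have key : cohenChain M p L (n + 1) ≤ ((cohenChain M p L (n + 2)).map q).comap q := by
      refine Subring.closure_le.2 ?_
      rintro _ (((⟨x, hx, rfl⟩ | ⟨x, hx, rfl⟩) | hx) | hx)
      · obtain ⟨y, hy, hxy⟩ := ih hx
        refine ⟨y ^ p, pow_mem_cohenChain_succ hy, Ideal.Quotient.eq.2 ?_⟩
        obtain ⟨d, hd⟩ : ∃ d, x ^ p - y ^ p = (x - y) ^ p + p * (d * (x - y)) := by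
          obtain ⟨d, hd⟩ := exists_add_pow_prime_eq hp y (x - y)
          rw [add_sub_cancel] at hd
          exact ⟨y * d, by linear_combination hd⟩
        rw [← neg_mem_iff, neg_sub, hd]
        refine add_mem ?_ ?_
        · have hpow := Ideal.pow_mem_pow hxy p
          rw [← pow_mul] at hpow
          refine Ideal.pow_le_pow_right ?_ hpow
          have := hp.two_le
          nlinarith
        · rw [pow_succ' M (n + 1)]
          exact Ideal.mul_mem_mul hpM (Ideal.mul_mem_left _ _ hxy)
      · obtain ⟨y, hy, hxy⟩ := ih hx
        refine ⟨p * y, mul_mem_cohenChain_succ hy, Ideal.Quotient.eq.2 ?_⟩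
        rw [← neg_mem_iff, neg_sub]
        change (p : T) * x - p * y ∈ _
        rw [← mul_sub, pow_succ' M (n + 1)]
        exact Ideal.mul_mem_mul hpM hxy
      · refine ⟨0, (cohenChain M p L (n + 2)).zero_mem, ?_⟩
        rw [map_zero]
        exact (Ideal.Quotient.eq_zero_iff_mem.2 hx).symm
      · exact ⟨_, subset_cohenChain _ hx, rfl⟩
    obtain ⟨y, hy, hyx⟩ := key hx
    refine ⟨y, hy, ?_⟩
    rw [← neg_mem_iff, neg_sub]
    exact Ideal.Quotient.eq.1 hyx

lemma Subring.exists_finset_mem_closure_union {ι : Type*} (E : Set T) (f : ι → T) (B : Set ι)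
    {x : T} (hx : x ∈ Subring.closure (E ∪ f '' B)) :
    ∃ s : Finset ι, (s : Set ι) ⊆ B ∧ x ∈ Subring.closure (E ∪ f '' s) := by
  classical
  have mono : ∀ s s' : Finset ι, s ⊆ s' →
      Subring.closure (E ∪ f '' s) ≤ Subring.closure (E ∪ f '' s') := fun s s' h =>
    Subring.closure_mono (Set.union_subset_union_right _ (Set.image_mono (by exact_mod_cast h)))
  induction hx using Subring.closure_induction with
  | mem x hx =>
    rcases hx with hx | ⟨b, hb, rfl⟩
    · exact ⟨∅, by simp, Subring.subset_closure (Or.inl hx)⟩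
    · exact ⟨{b}, by simpa using hb, Subring.subset_closure (Or.inr ⟨b, by simp, rfl⟩)⟩
  | zero => exact ⟨∅, by simp, zero_mem _⟩
  | one => exact ⟨∅, by simp, one_mem _⟩
  | add x y _ _ hx hy =>
    obtain ⟨s, hs, hxs⟩ := hx
    obtain ⟨t, ht, hyt⟩ := hy
    exact ⟨s ∪ t, by simp [hs, ht], add_mem (mono _ _ Finset.subset_union_left hxs)
      (mono _ _ Finset.subset_union_right hyt)⟩
  | neg x _ hx =>
    obtain ⟨s, hs, hxs⟩ := hx
    exact ⟨s, hs, neg_mem hxs⟩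
  | mul x y _ _ hx hy =>
    obtain ⟨s, hs, hxs⟩ := hx
    obtain ⟨t, ht, hyt⟩ := hy
    exact ⟨s ∪ t, by simp [hs, ht], mul_mem (mono _ _ Finset.subset_union_left hxs)
      (mono _ _ Finset.subset_union_right hyt)⟩

/-- The elements of a ring which are `p`-th powers modulo an ideal containing `p`. -/
def Ideal.frobeniusPreimage {U : Type*} [CommRing U] (Q : Ideal U) (hp : p.Prime)
    (hpQ : (p : U) ∈ Q) : Subring U where
  carrier := {z | ∃ x, z - x ^ p ∈ Q}
  mul_mem' := by
    rintro z z' ⟨x, hx⟩ ⟨x', hx'⟩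
    refine ⟨x * x', ?_⟩
    have : z * z' - (x * x') ^ p = z * (z' - x' ^ p) + x' ^ p * (z - x ^ p) := by ring
    rw [this]
    exact add_mem (Q.mul_mem_left _ hx') (Q.mul_mem_left _ hx)
  one_mem' := ⟨1, by simp⟩
  add_mem' := by
    rintro z z' ⟨x, hx⟩ ⟨x', hx'⟩
    obtain ⟨r, hr⟩ := exists_add_pow_prime_eq hp x x'
    refine ⟨x + x', ?_⟩
    have : z + z' - (x + x') ^ p = (z - x ^ p) + (z' - x' ^ p) - p * (x * x' * r) := by
      rw [hr]; ring
    rw [this]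
    exact sub_mem (add_mem hx hx') (Q.mul_mem_right _ hpQ)
  zero_mem' := ⟨0, by simp [hp.ne_zero]⟩
  neg_mem' := by
    rintro z ⟨x, hx⟩
    obtain ⟨r, hr⟩ := exists_add_pow_prime_eq hp x (-x)
    rw [add_neg_cancel, zero_pow hp.ne_zero] at hr
    refine ⟨-x, ?_⟩
    have : -z - (-x) ^ p = -(z - x ^ p) + p * (x * -x * r) := by
      linear_combination hr
    rw [this]
    exact add_mem (neg_mem hx) (Q.mul_mem_right _ hpQ)

lemma exists_mem_cohenChain_sub_mul_mem {k : Type*} [Field k] [LinearOrder k] [Fact p.Prime]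
    [CharP k p] (π : T →+* k) (hker : ∀ x, π x = 0 ↔ x ∈ M) (lift : k → T)
    (hlift : ∀ c, π (lift c) = c) (B : Set k)
    (hB : ∀ b ∈ B, b ∉ Subfield.closure (Set.range (fun x : k => x ^ p) ∪ {c | c ∈ B ∧ c < b}))
    (n : ℕ) {x : T} (hx : x ∈ cohenChain M p (lift '' B) n) (hx0 : π x = 0) :
    ∃ u ∈ cohenChain M p (lift '' B) (n - 1), x - p * u ∈ M ^ (n + 1) := by
  have hp : p.Prime := Fact.out
  induction n generalizing x with
  | zero => exact ⟨0, zero_mem _, by simpa using (hker x).1 hx0⟩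
  | succ n ih =>
    let U := cohenChain M p (lift '' B) n
    let Q : Ideal U := Ideal.span {(p : U)} ⊔ (M ^ (n + 2)).comap U.subtype
    have hpQ : (p : U) ∈ Q := Ideal.mem_sup_left (Ideal.mem_span_singleton_self _)
    have hQM : ∀ z ∈ Q, π z = 0 := by
      have : Q ≤ RingHom.ker (π.comp U.subtype) := by
        refine sup_le ?_ fun z hz => ?_
        · rw [Ideal.span_singleton_le_iff_mem, RingHom.mem_ker]
          simp
        · exact (hker z).2 (Ideal.pow_le_self (Nat.succ_ne_zero (n + 1)) hz)
      exact fun z hz => this hz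
    let E : Subring T := (Q.frobeniusPreimage hp hpQ).map U.subtype
    let Q' : AddSubgroup T := Q.toAddSubgroup.map U.subtype.toAddMonoidHom
    have hxE : ∃ s : Finset k, (s : Set k) ⊆ B ∧
        x ∈ Subring.closure ((E : Set T) ∪ lift '' s) := by
      refine Subring.exists_finset_mem_closure_union _ _ _ (Subring.closure_mono ?_ hx)
      rintro _ (((⟨x, hx, rfl⟩ | ⟨x, hx, rfl⟩) | hx) | hx)
      · exact Or.inl ⟨⟨x, hx⟩ ^ p, ⟨⟨x, hx⟩, by simp⟩, rfl⟩
      · refine Or.inl ⟨(p : U) * ⟨x, hx⟩, ⟨0, ?_⟩, by simp⟩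
        rw [zero_pow hp.ne_zero, sub_zero]
        exact Q.mul_mem_right _ hpQ
      · refine Or.inl ⟨⟨_, mem_cohenChain_of_mem_pow
          (Ideal.pow_le_pow_right (Nat.le_succ _) hx)⟩, ⟨0, ?_⟩, rfl⟩
        rw [zero_pow hp.ne_zero, sub_zero]
        exact Ideal.mem_sup_right hx
      · exact Or.inr hx
    obtain ⟨s, hs, hxs⟩ := hxE
    have hxQ : x ∈ Q' := by
      refine mem_of_mem_closure_pBasis_of_residue_eq_zero π lift hlift B hB U E Q'
        (fun b hb => subset_cohenChain _ ⟨b, hb, rfl⟩) ?_ ?_ ?_ ?_ s hs x hxs hx0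
      · rintro u hu _ ⟨q, hq, rfl⟩
        exact ⟨⟨u, hu⟩ * q, Q.mul_mem_left _ hq, rfl⟩
      · exact fun u hu => ⟨⟨u, hu⟩ ^ p, ⟨⟨u, hu⟩, by simp⟩, rfl⟩
      · rintro _ ⟨z, ⟨y, hy⟩, rfl⟩
        refine ⟨π y, ?_⟩
        have h1 := hQM _ hy
        simp only [AddSubgroupClass.coe_sub, SubmonoidClass.coe_pow, map_sub, map_pow, sub_eq_zero] at h1
        exact h1.symm
      · rintro _ ⟨z, ⟨y, hy⟩, rfl⟩ hz0
        refine ⟨z, ?_, rfl⟩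
        have h1 := hQM _ hy
        simp only [AddSubgroupClass.coe_sub, SubmonoidClass.coe_pow, map_sub, map_pow, sub_eq_zero] at h1
        have h2 : π y = 0 := by
          change π z = 0 at hz0
          rw [hz0] at h1
          exact pow_eq_zero_iff hp.ne_zero |>.1 h1.symm
        obtain ⟨u, hu, hm⟩ := ih y.2 h2
        have hpu : ∀ v ∈ cohenChain M p (lift '' B) (n - 1), (p : T) * v ∈ U := by
          intro v hv
          rcases Nat.eq_zero_or_pos n with hn | hn
          · simp only [U, hn]
            trivial
          · have := mul_mem_cohenChain_succ hv
            rwa [Nat.sub_add_cancel hn] at this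
        let a : U := ⟨p * u, hpu u hu⟩
        let w : U := ⟨p * (u * u), hpu _ (mul_mem hu hu)⟩
        have ha : a ^ p ∈ Q := by
          obtain ⟨r, hr⟩ := Nat.exists_eq_add_of_le' hp.two_le
          have : a ^ p = p * (w * a ^ r) := by
            have e : ((p : T) * u) ^ p = ((p : T) * u) ^ (r + 2) :=
              congrArg (fun m => ((p : T) * u) ^ m) hr
            ext
            simp only [a, w, Subring.coe_pow, Subring.coe_mul, Subring.coe_natCast]
            rw [e]
            ring
          rw [this]
          exact Q.mul_mem_right _ hpQ
        have hya : (y - a) ^ p ∈ Q := by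
          have hpow := Ideal.pow_mem_pow hm p
          rw [← pow_mul] at hpow
          refine Ideal.mem_sup_right (Ideal.mem_comap.2 (Ideal.pow_le_pow_right ?_ hpow))
          have := hp.two_le
          nlinarith
        have hyp : y ^ p ∈ Q := by
          obtain ⟨r, hr⟩ := exists_add_pow_prime_eq hp a (y - a)
          rw [add_sub_cancel] at hr
          rw [hr]
          refine add_mem (add_mem ha hya) ?_
          simp only [mul_assoc]
          exact Q.mul_mem_right _ hpQ
        have := add_mem hy hyp
        rwa [sub_add_cancel] at this
    obtain ⟨z, hz, rfl⟩ := hxQ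
    obtain ⟨y, hy, m, hm, hym⟩ := Submodule.mem_sup.1 hz
    obtain ⟨u, rfl⟩ := Ideal.mem_span_singleton'.1 hy
    refine ⟨u, u.2, ?_⟩
    have : (z : T) - p * u = m := by
      rw [← hym]
      simp only [Subring.coe_add, Subring.coe_mul, Subring.coe_natCast]
      ring
    change (z : T) - p * u ∈ _
    rw [this]
    exact hm

end CohenChain

section CoefficientRing

open IsLocalRing

/-- A coefficient ring of a local ring, with a generator of its maximal ideal. -/
structure IsCoefficientSubring {T : Type*} [CommRing T] [IsLocalRing T] (V : Subring T) (ϖ : T) :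
    Prop where
  mem_of_mul_eq_one : ∀ x ∈ V, ∀ y, x * y = 1 → y ∈ V
  mem : ϖ ∈ V
  mem_maximalIdeal : ϖ ∈ maximalIdeal T
  exists_eq_mul : ∀ x ∈ V, x ∈ maximalIdeal T → ∃ u ∈ V, x = ϖ * u
  exists_sub_mem : ∀ t, ∃ v ∈ V, t - v ∈ maximalIdeal T
  exists_series : ∀ v : ℕ → T, (∀ n, v n ∈ V) →
    ∃ w ∈ V, ∀ N, w - ∑ n ∈ Finset.range N, v n * ϖ ^ n ∈ maximalIdeal T ^ N
  charZero : ϖ ≠ 0 → CharZero T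

lemma exists_isCoefficientSubring_of_charZero {T : Type*} [CommRing T] [IsLocalRing T]
    [IsAdicComplete (maximalIdeal T) T] [CharZero (ResidueField T)] :
    ∃ (V : Subring T) (ϖ : T), IsCoefficientSubring V ϖ := by
  obtain ⟨hQ⟩ : Nonempty (Algebra ℚ T) := EqualCharZero.nonempty_algebraRat_iff T |>.2 fun I hI => by
    have : Nontrivial (T ⧸ I) := Ideal.Quotient.nontrivial_iff.2 hI
    have : CharZero (T ⧸ maximalIdeal T) := inferInstanceAs (CharZero (ResidueField T))
    exact (Ideal.Quotient.factor (le_maximalIdeal hI)).charZero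
  let k := T ⧸ maximalIdeal T
  let _ : Field k := Ideal.Quotient.field _
  have : Algebra.FormallySmooth ℚ k := by
    obtain ⟨ι, v, hv⟩ := exists_isTranscendenceBasis' ℚ k
    have := hv.isAlgebraic_field
    exact .of_algebraicIndependent_of_isSeparable hv.1
  obtain ⟨g, hg⟩ := Algebra.FormallySmooth.exists_mkₐ_comp_eq_of_isAdicComplete
    (R := ℚ) (A := k) (S := T) (I := maximalIdeal T) (AlgHom.id ℚ k)
  have hg' : ∀ c : k, Ideal.Quotient.mk (maximalIdeal T) (g c) = c := fun c =>
    DFunLike.congr_fun hg c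
  refine ⟨g.toRingHom.range, 0, ?_, zero_mem _, zero_mem _, ?_, fun t => ?_, fun v hv => ?_,
    fun h => absurd rfl h⟩
  · rintro _ ⟨c, rfl⟩ y hy
    have hc : c ≠ 0 := by
      rintro rfl
      simp at hy
    refine ⟨c⁻¹, ?_⟩
    have h1 : g c * g c⁻¹ = 1 := by rw [← map_mul, mul_inv_cancel₀ hc, map_one]
    exact (eq_comm.1 (left_inv_eq_right_inv ((mul_comm _ _).trans hy) h1))
  · rintro _ ⟨c, rfl⟩ h
    have : c = 0 := by
      rw [← hg' c]
      exact Ideal.Quotient.eq_zero_iff_mem.2 h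
    exact ⟨0, zero_mem _, by simp [this]⟩
  · refine ⟨g (Ideal.Quotient.mk _ t), ⟨_, rfl⟩, ?_⟩
    rw [← Ideal.Quotient.eq, hg']
  · refine ⟨v 0, hv 0, fun N => ?_⟩
    cases N with
    | zero => simp
    | succ N => simp [Finset.sum_range_succ']

lemma exists_isCoefficientSubring_of_charP {T : Type*} [CommRing T] [IsDomain T] [IsLocalRing T]
    [IsNoetherianRing T] [IsAdicComplete (maximalIdeal T) T] (p : ℕ) [hp : Fact p.Prime]
    [CharP (ResidueField T) p] :
    ∃ (V : Subring T) (ϖ : T), IsCoefficientSubring V ϖ := by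
  set M := maximalIdeal T
  let π := residue T
  have hπ : Function.Surjective π := residue_surjective
  have hker : ∀ x, π x = 0 ↔ x ∈ M := fun x => residue_eq_zero_iff x
  obtain ⟨_, B, hB, hBt⟩ := exists_pBasis (ResidueField T) p
  let lift := Function.surjInv hπ
  have hlift : ∀ c, π (lift c) = c := Function.surjInv_eq hπ
  have hL : Subfield.closure (Set.range (fun x : ResidueField T => x ^ p) ∪ π '' (lift '' B)) =
      ⊤ := by
    rwa [Set.image_image, Set.image_congr fun c _ => hlift c, Set.image_id']
  have hpM : (p : T) ∈ M := by
    rw [← hker, map_natCast, CharP.cast_eq_zero]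
  let U := cohenChain M p (lift '' B)
  let V : Subring T := ⨅ n, U n
  have hV : ∀ x, x ∈ V ↔ ∀ n, x ∈ U n := fun x => Subring.mem_iInf
  have closed : ∀ x, (∀ n, ∃ v ∈ V, x - v ∈ M ^ n) → x ∈ V := by
    refine fun x hx => (hV x).2 fun n => ?_
    obtain ⟨v, hv, hxv⟩ := hx (n + 1)
    rw [← sub_add_cancel x v]
    exact add_mem (mem_cohenChain_of_mem_pow hxv) ((hV v).1 hv n)
  refine ⟨V, p, fun x hx y hxy => (hV y).2 fun n =>
    mem_cohenChain_of_mul_eq_one hp.out.pos ((hV x).1 hx n) hxy, natCast_mem V p, hpM, ?_,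
    fun t => ?_, fun v hv => ?_, fun h0 => ?_⟩
  · intro x hx hxM
    have hC := fun n => exists_mem_cohenChain_sub_mul_mem π hker lift hlift B hB n
      ((hV x).1 hx n) ((hker x).2 hxM)
    choose u hu hxu using hC
    obtain ⟨y, hy⟩ : ∃ y, x = p * y := by
      have : x ∈ Ideal.span {(p : T)} := Ideal.mem_of_forall_exists_sub_mem_pow _ fun n =>
        ⟨p * u n, Ideal.mul_mem_right _ _ (Ideal.mem_span_singleton_self _),
          Ideal.pow_le_pow_right (Nat.le_succ n) (hxu n)⟩
      obtain ⟨y, rfl⟩ := Ideal.mem_span_singleton'.1 this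
      exact ⟨y, mul_comm _ _⟩
    by_cases hp0 : (p : T) = 0
    · exact ⟨0, zero_mem _, by rw [hy, hp0]; simp⟩
    obtain ⟨c, hc⟩ := Ideal.exists_pow_inf_eq_pow_smul M (Ideal.span {(p : T)} : Submodule T T)
    refine ⟨y, (hV y).2 fun j => ?_, hy⟩
    have h1 : (p : T) * (y - u (j + c + 1)) ∈ M ^ (j + c + 2) := by
      rw [mul_sub, ← hy]
      exact hxu _
    have h2 : (p : T) * (y - u (j + c + 1)) ∈ M ^ (j + c + 2 - c) * Ideal.span {(p : T)} := by
      have h3 : (p : T) * (y - u (j + c + 1)) ∈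
          (M ^ (j + c + 2) • ⊤ ⊓ Ideal.span {(p : T)} : Submodule T T) :=
        ⟨by simpa using h1, Ideal.mul_mem_right _ _ (Ideal.mem_span_singleton_self _)⟩
      rw [hc _ (by omega)] at h3
      exact Submodule.smul_mono le_rfl inf_le_right h3
    obtain ⟨z, hz, hzp⟩ := Ideal.mem_mul_span_singleton.1 h2
    have h4 : y - u (j + c + 1) = z := mul_left_cancel₀ hp0 (by rw [← hzp, mul_comm])
    rw [← sub_add_cancel y (u (j + c + 1)), h4]
    exact add_mem (mem_cohenChain_of_mem_pow (Ideal.pow_le_pow_right (by omega) hz))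
      (cohenChain_antitone (by omega) (hu (j + c + 1)))
  · have step : ∀ n (x : U n), ∃ y : U (n + 1), (x : T) - y ∈ M ^ (n + 1) := fun n x => by
      obtain ⟨y, hy, hxy⟩ := exists_mem_cohenChain_succ_sub_mem hp.out π hπ
        (fun x => (hker x).1) hpM hL n x.2
      exact ⟨⟨y, hy⟩, hxy⟩
    choose s hs using step
    let v : ∀ n, U n := fun n => Nat.rec (motive := fun n => U n) ⟨t, trivial⟩ s n
    obtain ⟨w, hw⟩ := exists_adic_limit M (fun n => (v n).1) fun n =>
      Ideal.pow_le_pow_right (Nat.le_succ n) (hs n (v n))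
    have hw' : ∀ n, (v n).1 - w ∈ M ^ (n + 1) := fun n => by
      rw [← sub_add_sub_cancel _ (v (n + 1)).1]
      exact add_mem (hs n (v n)) (hw (n + 1))
    refine ⟨w, (hV w).2 fun n => ?_, ?_⟩
    · rw [← sub_sub_cancel (v n).1 w]
      exact sub_mem (v n).2 (mem_cohenChain_of_mem_pow (hw' n))
    · have h1 : t - w ∈ M ^ (0 + 1) := hw' 0
      rwa [zero_add, pow_one] at h1
  · obtain ⟨w, hw⟩ := exists_adic_limit M (fun N => ∑ n ∈ Finset.range N, v n * (p : T) ^ n)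
      fun n => by
        rw [Finset.sum_range_succ, sub_add_cancel_left, neg_mem_iff]
        exact Ideal.mul_mem_left _ _ (Ideal.pow_mem_pow hpM n)
    have hw' : ∀ N, w - ∑ n ∈ Finset.range N, v n * (p : T) ^ n ∈ M ^ N := fun N => by
      rw [← neg_mem_iff, neg_sub]
      exact hw N
    exact ⟨w, closed w fun N => ⟨_, sum_mem fun n _ => mul_mem (hv n)
      (pow_mem (natCast_mem V p) n), hw' N⟩, hw'⟩
  · obtain ⟨q, hq⟩ := CharP.exists T
    rcases CharP.char_is_prime_or_zero T q with hq' | rfl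
    · have h1 : ((q : ℕ) : ResidueField T) = 0 := by
        rw [← map_natCast π, CharP.cast_eq_zero, map_zero]
      have h2 : p = q := ((Nat.prime_dvd_prime_iff_eq hp.out hq').1
        ((CharP.cast_eq_zero_iff (ResidueField T) p q).1 h1))
      exact absurd (h2 ▸ CharP.cast_eq_zero T q) h0
    · exact CharP.charP_to_charZero T

lemma exists_isCoefficientSubring (T : Type*) [CommRing T] [IsDomain T] [IsLocalRing T]
    [IsNoetherianRing T] [IsAdicComplete (maximalIdeal T) T] :
    ∃ (V : Subring T) (ϖ : T), IsCoefficientSubring V ϖ := by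
  obtain ⟨p, hp⟩ := CharP.exists (ResidueField T)
  rcases CharP.char_is_prime_or_zero (ResidueField T) p with hp' | rfl
  · have : Fact p.Prime := ⟨hp'⟩
    exact exists_isCoefficientSubring_of_charP p
  · have := CharP.charP_to_charZero (ResidueField T)
    exact exists_isCoefficientSubring_of_charZero

lemma HasFiniteClosures.of_isField {V : Type u} [CommRing V] [IsDomain V] [IsNoetherianRing V]
    (h : IsField V) : HasFiniteClosures V := by
  intro L _ _ _ _ _
  have : Module.Finite V (FractionRing V) := Module.Finite.of_surjective
    (Algebra.linearMap V (FractionRing V)) (IsFractionRing.surjective_iff_isField.2 h)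
  have : Module.Finite V L := .trans (FractionRing V) L
  have : IsNoetherian V L := isNoetherian_of_isNoetherianRing_of_finite V L
  exact Module.Finite.of_injective (integralClosure V L).val.toLinearMap Subtype.val_injective

namespace IsCoefficientSubring

variable {T : Type u} [CommRing T] [IsLocalRing T]
  {V : Subring T} {ϖ : T}

lemma isUnit (h : IsCoefficientSubring V ϖ) (x : V) (hx : (x : T) ∉ maximalIdeal T) :
    IsUnit x := by
  obtain ⟨y, hy⟩ := (notMem_maximalIdeal.1 hx).exists_right_inv
  exact IsUnit.of_mul_eq_one ⟨y, h.mem_of_mul_eq_one x x.2 y hy⟩ (Subtype.ext hy)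

lemma notMem_of_isUnit {x : V} (hx : IsUnit x) : (x : T) ∉ maximalIdeal T :=
  notMem_maximalIdeal.2 (hx.map V.subtype)

lemma isLocalRing (h : IsCoefficientSubring V ϖ) : IsLocalRing V :=
  IsLocalRing.of_nonunits_add fun a b ha hb hab => by
    have ha' : (a : T) ∈ maximalIdeal T := by
      by_contra h'
      exact ha (h.isUnit a h')
    have hb' : (b : T) ∈ maximalIdeal T := by
      by_contra h'
      exact hb (h.isUnit b h')
    exact notMem_of_isUnit hab (add_mem ha' hb')

lemma maximalIdeal_eq (h : IsCoefficientSubring V ϖ) [IsLocalRing V] :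
    maximalIdeal V = Ideal.span {⟨ϖ, h.mem⟩} := by
  refine le_antisymm (fun x hx => ?_) ?_
  · have hx' : (x : T) ∈ maximalIdeal T := by
      by_contra h'
      exact (IsLocalRing.mem_maximalIdeal x).1 hx (h.isUnit x h')
    obtain ⟨u, hu, hxu⟩ := h.exists_eq_mul x x.2 hx'
    exact Ideal.mem_span_singleton'.2 ⟨⟨u, hu⟩, Subtype.ext ((mul_comm _ _).trans hxu.symm)⟩
  · rw [Ideal.span_singleton_le_iff_mem, IsLocalRing.mem_maximalIdeal]
    exact fun h' => notMem_of_isUnit h' h.mem_maximalIdeal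

lemma isField (h : IsCoefficientSubring V ϖ) (h0 : ϖ = 0) : IsField V := by
  refine ⟨⟨0, 1, zero_ne_one⟩, mul_comm, fun {x} hx => ?_⟩
  refine (h.isUnit x fun hxM => hx ?_).exists_right_inv
  obtain ⟨u, hu, hxu⟩ := h.exists_eq_mul x x.2 hxM
  exact Subtype.ext (by simpa [h0] using hxu)

variable [IsDomain T] [IsNoetherianRing T]

lemma isDiscreteValuationRing (h : IsCoefficientSubring V ϖ) (h0 : ϖ ≠ 0) :
    IsDiscreteValuationRing V := by
  have := h.isLocalRing
  have hprime : Irreducible (⟨ϖ, h.mem⟩ : V) := by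
    refine ⟨fun h' => notMem_of_isUnit h' h.mem_maximalIdeal, fun a b hab => ?_⟩
    by_contra! hn
    have ha : a ∈ maximalIdeal V := hn.1
    have hb : b ∈ maximalIdeal V := hn.2
    rw [h.maximalIdeal_eq] at ha hb
    obtain ⟨a, rfl⟩ := Ideal.mem_span_singleton'.1 ha
    obtain ⟨b, rfl⟩ := Ideal.mem_span_singleton'.1 hb
    have h1 : ϖ * 1 = ϖ * (a * b * ϖ) := by
      have := congrArg Subtype.val hab
      simp only [Subring.coe_mul] at this
      rw [mul_one]
      refine this.trans ?_
      ring
    have h2 := mul_left_cancel₀ h0 h1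
    refine (IsUnit.of_mul_eq_one (M := T) (a * b) ((mul_comm _ _).trans h2.symm) : IsUnit ϖ)
      |> fun h' => ?_
    exact (IsLocalRing.mem_maximalIdeal ϖ).1 h.mem_maximalIdeal h'
  refine IsDiscreteValuationRing.ofHasUnitMulPowIrreducibleFactorization
    ⟨⟨ϖ, h.mem⟩, hprime, fun {x} hx => ?_⟩
  by_contra! hn
  have key : ∀ n : ℕ, ∃ u : V, x = ⟨ϖ, h.mem⟩ ^ n * u := by
    intro n
    induction n with
    | zero => exact ⟨x, by simp⟩
    | succ n ih =>
      obtain ⟨u, hu⟩ := ih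
      have hu' : (u : T) ∈ maximalIdeal T := by
        by_contra h'
        exact hn n ⟨(h.isUnit u h').unit, hu.symm⟩
      obtain ⟨w, hw, huw⟩ := h.exists_eq_mul u u.2 hu'
      refine ⟨⟨w, hw⟩, ?_⟩
      rw [hu, pow_succ, mul_assoc]
      congr 1
      exact Subtype.ext huw
  refine hx (Subtype.ext ?_)
  have : IsHausdorff (maximalIdeal T) T := inferInstance
  refine eq_zero_of_forall_mem_pow (I := maximalIdeal T) fun n => ?_
  obtain ⟨u, hu⟩ := key n
  rw [hu, Subring.coe_mul, Subring.coe_pow]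
  exact Ideal.mul_mem_right _ _ (Ideal.pow_mem_pow h.mem_maximalIdeal n)

lemma isPrincipalIdealRing (h : IsCoefficientSubring V ϖ) : IsPrincipalIdealRing V := by
  by_cases h0 : ϖ = 0
  · exact (h.isField h0).isPrincipalIdealRing
  · have := h.isDiscreteValuationRing h0
    infer_instance

lemma hasFiniteClosures (h : IsCoefficientSubring V ϖ) : HasFiniteClosures V := by
  have := h.isPrincipalIdealRing
  by_cases h0 : ϖ = 0
  · exact .of_isField (h.isField h0)
  · have := h.charZero h0
    have : CharZero V := ⟨fun m n hmn => by
      have := congrArg Subtype.val hmn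
      exact_mod_cast this⟩
    exact .of_charZero

end IsCoefficientSubring

end CoefficientRing

namespace PowerSeries

section Normal

variable {R K : Type*} [CommRing R] [IsDomain R] [IsNoetherianRing R] [IsIntegrallyClosed R]
  [Field K] [Algebra R K] [IsFractionRing R K]

/-- A power series over the fraction field of a normal Noetherian domain `R`, whose powers have a
common denominator in `R⟦X⟧`, has coefficients in `R`. -/
lemma exists_map_eq_of_forall_mul_pow (h : PowerSeries R) (h0 : h ≠ 0) (q : PowerSeries K)
    (hq : ∀ n : ℕ, ∃ s : PowerSeries R, map (algebraMap R K) h * q ^ n = map (algebraMap R K) s) :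
    ∃ r : PowerSeries R, map (algebraMap R K) r = q := by
  let φ : PowerSeries R →+* PowerSeries K := map (algebraMap R K)
  have hinj : Function.Injective (algebraMap R K) := IsFractionRing.injective R K
  have hφ : Function.Injective φ := map_injective _ hinj
  let _ : Algebra (PowerSeries R) (PowerSeries K) := φ.toAlgebra
  have hqa : IsAlmostIntegral (PowerSeries R) q :=
    ⟨h, mem_nonZeroDivisors_of_ne_zero h0, fun n => by
      obtain ⟨s, hs⟩ := hq n
      exact ⟨s, hs.symm⟩⟩
  have key : ∀ i, ∃ r : R, algebraMap R K r = coeff i q := by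
    intro i
    induction i using Nat.strong_induction_on with
    | _ i ih =>
    choose r hr using ih
    let t : PowerSeries R := mk fun j => if hj : j < i then r j hj else 0
    have ht : ∀ j < i, coeff j (q - φ t) = 0 := fun j hj => by
      simp [φ, t, hj, hr]
    have hti : coeff i (q - φ t) = coeff i q := by simp [φ, t]
    have ha : IsAlmostIntegral (PowerSeries R) (q - φ t) :=
      (completeIntegralClosure (PowerSeries R) (PowerSeries K)).sub_mem hqa
        (Subalgebra.algebraMap_mem _ t)
    obtain ⟨w, hw⟩ := X_pow_dvd_iff.2 ht
    obtain ⟨d, hd, hdn⟩ := ha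
    have hd0 : d ≠ 0 := nonZeroDivisors.ne_zero hd
    have hcoeff : coeff i q = constantCoeff w := by
      rw [← hti, hw]
      simpa using coeff_X_pow_mul w i 0
    have hintegral : IsAlmostIntegral R (coeff i q) := by
      refine ⟨constantCoeff (divXPowOrder d), mem_nonZeroDivisors_of_ne_zero
        (mt constantCoeff_divXPowOrder_eq_zero_iff.1 hd0), fun n => ?_⟩
      obtain ⟨s, hs⟩ := hdn n
      refine ⟨coeff (d.order.toNat + i * n) s, ?_⟩
      have h1 : φ s = X ^ (d.order.toNat + i * n) * (φ (divXPowOrder d) * w ^ n) := by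
        have h2 : φ s = φ d * (q - φ t) ^ n := hs
        rw [h2, hw, mul_pow, pow_add, pow_mul]
        nth_rw 1 [← X_pow_order_mul_divXPowOrder (f := d)]
        rw [map_mul, map_pow, show φ X = X from map_X _]
        ring
      have h3 : coeff (0 + (d.order.toNat + i * n)) (φ s) =
          coeff 0 (φ (divXPowOrder d) * w ^ n) := by
        rw [h1, coeff_X_pow_mul]
      rw [zero_add, coeff_zero_eq_constantCoeff_apply, map_mul, map_pow, ← hcoeff] at h3
      rw [Algebra.smul_def]
      have h4 : constantCoeff (φ (divXPowOrder d)) =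
          algebraMap R K (constantCoeff (divXPowOrder d)) := by
        rw [← coeff_zero_eq_constantCoeff_apply, ← coeff_zero_eq_constantCoeff_apply, coeff_map]
      rw [h4] at h3
      exact (coeff_map _ _ _).symm.trans h3
    have hintegral' : IsIntegral R (coeff i q) := hintegral.isIntegral
    exact IsIntegrallyClosed.isIntegral_iff.1 hintegral'
  choose r hr using key
  exact ⟨mk r, by ext i; simp [hr]⟩

instance isIntegrallyClosed : IsIntegrallyClosed (PowerSeries R) := by
  let K := FractionRing R
  let F := FractionRing (PowerSeries R)
  let F' := FractionRing (PowerSeries K)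
  let φ : PowerSeries R →+* PowerSeries K := map (algebraMap R K)
  have hφ : Function.Injective φ := map_injective _ (IsFractionRing.injective R K)
  have hφ' : Function.Injective ((algebraMap (PowerSeries K) F').comp φ) :=
    (IsFractionRing.injective (PowerSeries K) F').comp hφ
  let ψ : F →+* F' := IsFractionRing.lift hφ'
  have hψ : ∀ f, ψ (algebraMap _ F f) = algebraMap _ F' (φ f) := fun f =>
    IsFractionRing.lift_algebraMap hφ' f
  refine (isIntegrallyClosed_iff F).2 fun {x} hx => ?_
  have hx' : IsIntegral (PowerSeries K) (ψ x) :=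
    hx.map_of_comp_eq φ ψ (RingHom.ext fun f => (hψ f).symm)
  have : IsIntegrallyClosed (PowerSeries K) := inferInstance
  obtain ⟨q, hq⟩ := IsIntegrallyClosed.isIntegral_iff.1 hx'
  obtain ⟨h, hh, hn⟩ := hx.isAlmostIntegral
  obtain ⟨r, hr⟩ := exists_map_eq_of_forall_mul_pow (K := K) h (nonZeroDivisors.ne_zero hh) q
    fun n => by
      obtain ⟨s, hs⟩ := hn n
      refine ⟨s, IsFractionRing.injective (PowerSeries K) F' ?_⟩
      change algebraMap _ F' (φ h * q ^ n) = algebraMap _ F' (φ s)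
      rw [map_mul, map_pow, hq, ← hψ, ← hψ, ← map_pow, ← map_mul, ← Algebra.smul_def, hs]
  refine ⟨r, ψ.injective ?_⟩
  rw [hψ, ← hq]
  exact congrArg _ hr

end Normal

end PowerSeries

section FrobeniusRoot

lemma SpansModulo.span_pow {R T : Type*} [CommRing R] [CommRing T] {φ : R →+* T} {y : T}
    (h : SpansModulo φ (Ideal.span {y})) (n : ℕ) : SpansModulo φ (Ideal.span {y ^ n}) := by
  induction n with
  | zero => exact ⟨0, Fin.elim0, fun t => ⟨Fin.elim0, by simp⟩⟩
  | succ n ih =>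
    obtain ⟨k, e, he⟩ := ih
    obtain ⟨l, g, hg⟩ := h
    refine ⟨k + l, Fin.append e fun i => y ^ n * g i, fun t => ?_⟩
    obtain ⟨c, hc⟩ := he t
    obtain ⟨t', ht'⟩ := Ideal.mem_span_singleton.1 hc
    obtain ⟨v, hv⟩ := hg t'
    refine ⟨Fin.append c v, ?_⟩
    rw [Fin.sum_univ_add]
    simp only [Fin.append_left, Fin.append_right]
    have h1 : ∑ i, φ (v i) * (y ^ n * g i) = y ^ n * ∑ i, φ (v i) * g i := by
      rw [Finset.mul_sum]
      exact Finset.sum_congr rfl fun i _ => by ring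
    rw [← sub_sub, ht', h1, ← mul_sub, pow_succ, Ideal.mem_span_singleton]
    exact mul_dvd_mul_left _ (Ideal.mem_span_singleton.1 hv)

namespace PowerSeries

/-- Elements which are linearly independent over `R` modulo an ideal containing `X` are linearly
independent over `R⟦X⟧`. -/
lemma linearIndependent_of_quotient {R B ι : Type*} [Fintype ι] [CommRing R] [CommRing B]
    [IsDomain B] [Algebra (PowerSeries R) B] (hX0 : algebraMap (PowerSeries R) B X ≠ 0)
    {J : Ideal B} (hXJ : algebraMap (PowerSeries R) B X ∈ J) {b : ι → B}
    (h : ∀ c : ι → R, ∑ i, algebraMap (PowerSeries R) B (C (c i)) * b i ∈ J → ∀ i, c i = 0) :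
    LinearIndependent (PowerSeries R) b := by
  have key : ∀ (m : ℕ) (f : ι → PowerSeries R), ∑ i, f i • b i = 0 → ∀ i, X ^ m ∣ f i := by
    intro m
    induction m with
    | zero => intro f _ i; simp
    | succ m ih =>
      intro f hf
      have hdecomp : ∀ i, ∃ g, f i = C (constantCoeff (f i)) + X * g := fun i => by
        obtain ⟨g, hg⟩ := (X_dvd_iff (φ := f i - C (constantCoeff (f i)))).2 (by simp)
        exact ⟨g, by rw [← hg]; ring⟩
      choose g hg using hdecomp
      have hc : ∀ i, constantCoeff (f i) = 0 := by
        refine h _ ?_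
        have h1 : ∑ i, algebraMap (PowerSeries R) B (C (constantCoeff (f i))) * b i =
            - ∑ i, algebraMap (PowerSeries R) B X * (algebraMap (PowerSeries R) B (g i) * b i) := by
          rw [eq_neg_iff_add_eq_zero, ← Finset.sum_add_distrib, ← hf]
          refine Finset.sum_congr rfl fun i _ => ?_
          conv_rhs => rw [Algebra.smul_def, hg i, map_add, map_mul]
          ring
        rw [h1]
        exact neg_mem (sum_mem fun i _ => J.mul_mem_right _ hXJ)
      have hg' : ∀ i, f i = X * g i := fun i => by
        have := hg i
        rwa [hc i, map_zero, zero_add] at this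
      have h2 : ∑ i, g i • b i = 0 := by
        refine (mul_eq_zero.1 (?_ : algebraMap (PowerSeries R) B X * _ = 0)).resolve_left hX0
        rw [Finset.mul_sum, ← hf]
        refine Finset.sum_congr rfl fun i _ => ?_
        rw [hg' i, mul_smul, Algebra.smul_def X]
      intro i
      rw [hg' i, pow_succ']
      exact mul_dvd_mul_left _ (ih g h2 i)
  refine Fintype.linearIndependent_iff.2 fun f hf i => ?_
  ext n
  exact X_pow_dvd_iff.1 (key (n + 1) f hf i) n n.lt_succ_self

/-- A torsion-free extension of `R⟦X⟧` of finite rank which is closed under division by a `q`-th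
root of `X`, and all of whose elements have their `q`-th power in `R⟦X⟧`, is module-finite. -/
lemma finite_of_pow_mem {R B : Type u} [CommRing R] [IsDomain R] [IsNoetherianRing R]
    (hR : HasFiniteClosures R) [CommRing B] [IsDomain B] [Algebra (PowerSeries R) B]
    (hinj : Function.Injective (algebraMap (PowerSeries R) B)) (N : B →+* PowerSeries R) {q : ℕ}
    (hq : 0 < q) (hN : ∀ b, algebraMap (PowerSeries R) B (N b) = b ^ q) (y : B)
    (hy : y ^ q = algebraMap (PowerSeries R) B X) (hdvd : ∀ b, X ∣ N b → y ∣ b) (n : ℕ)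
    (hn : ∀ (ι : Type u) [Fintype ι] (b : ι → B), LinearIndependent (PowerSeries R) b →
      Fintype.card ι ≤ n) :
    Module.Finite (PowerSeries R) B := by
  have hNy : N y = X := hinj (by rw [hN, hy])
  have hX0 : algebraMap (PowerSeries R) B X ≠ 0 := (map_ne_zero_iff _ hinj).2 X_ne_zero
  let _ : Algebra R B := ((algebraMap (PowerSeries R) B).comp C).toAlgebra
  have hRB : ∀ r, algebraMap R B r = algebraMap (PowerSeries R) B (C r) := fun _ => rfl
  let J : Ideal B := RingHom.ker (constantCoeff.comp N)
  have hJ : ∀ b, b ∈ J ↔ X ∣ N b := fun b => by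
    rw [X_dvd_iff]
    exact RingHom.mem_ker
  have hJy : J = Ideal.span {y} := by
    ext b
    rw [hJ, Ideal.mem_span_singleton]
    refine ⟨hdvd b, fun h => ?_⟩
    rw [← hNy]
    exact map_dvd N h
  have hyJ : y ∈ J := hJy ▸ Ideal.mem_span_singleton_self y
  have hXJ : algebraMap (PowerSeries R) B X ∈ J := hy ▸ J.pow_mem_of_mem hyJ q hq
  have : J.IsPrime := RingHom.ker_isPrime _
  let A := B ⧸ J
  have hRA : ∀ r, algebraMap R A r = Ideal.Quotient.mk J (algebraMap (PowerSeries R) B (C r)) :=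
    fun _ => rfl
  have hNC : ∀ f, N (algebraMap (PowerSeries R) B f) = f ^ q := fun f => hinj (by
    rw [hN, map_pow])
  have hinjA : Function.Injective (algebraMap R A) := by
    rw [injective_iff_map_eq_zero]
    intro r hr
    rw [hRA, Ideal.Quotient.eq_zero_iff_mem, hJ, hNC, X_dvd_iff, map_pow] at hr
    simpa using eq_zero_of_pow_eq_zero hr
  have : Algebra.IsIntegral R A := by
    refine ⟨fun a => ?_⟩
    obtain ⟨b, rfl⟩ := Ideal.Quotient.mk_surjective a
    refine IsIntegral.of_pow hq ?_
    have h1 : (Ideal.Quotient.mk J b) ^ q = algebraMap R A (constantCoeff (N b)) := by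
      rw [hRA, ← map_pow, ← hN, Ideal.Quotient.eq, ← map_sub]
      obtain ⟨g, hg⟩ := (X_dvd_iff (φ := N b - C (constantCoeff (N b)))).2 (by simp)
      rw [hg, map_mul]
      exact J.mul_mem_right _ hXJ
    rw [h1]
    exact isIntegral_algebraMap
  have hfaith : FaithfulSMul R A := (faithfulSMul_iff_algebraMap_injective R A).2 hinjA
  have hrank : Module.rank R A ≤ n := by
    refine rank_le fun s hs => ?_
    choose lift hlift using Ideal.Quotient.mk_surjective (I := J)
    have h1 : LinearIndependent (PowerSeries R) fun i : s => lift i := by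
      refine linearIndependent_of_quotient hX0 hXJ fun c hc => ?_
      refine Fintype.linearIndependent_iff.1 hs c ?_
      rw [← Ideal.Quotient.eq_zero_iff_mem, map_sum] at hc
      rw [← hc]
      refine Finset.sum_congr rfl fun i _ => ?_
      rw [map_mul, hlift, Algebra.smul_def]
      rfl
    simpa using hn s _ h1
  let _ : Algebra (FractionRing R) (FractionRing A) :=
    FractionRing.liftAlgebra R (FractionRing A)
  have : IsScalarTower R (FractionRing R) (FractionRing A) :=
    FractionRing.isScalarTower_liftAlgebra R (FractionRing A)
  have : FiniteDimensional (FractionRing R) (FractionRing A) := by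
    rw [FiniteDimensional, ← Module.rank_lt_aleph0_iff,
      Algebra.IsAlgebraic.rank_of_isFractionRing R (FractionRing R) A (FractionRing A)]
    exact hrank.trans_lt (Cardinal.natCast_lt_aleph0)
  have hfin := hR (FractionRing A)
  have : Module.Finite R A := by
    let f : A →ₐ[R] integralClosure R (FractionRing A) :=
      (IsScalarTower.toAlgHom R A (FractionRing A)).codRestrict _ fun a =>
        (Algebra.IsIntegral.isIntegral a).algebraMap
    refine Module.Finite.of_injective f.toLinearMap fun a b hab => ?_
    exact IsFractionRing.injective A (FractionRing A) (congrArg Subtype.val hab)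
  have hspan : SpansModulo ((algebraMap (PowerSeries R) B).comp C) (Ideal.span {y}) := by
    obtain ⟨k, e, he⟩ := Module.Finite.exists_fin (R := R) (M := A)
    choose lift hlift using Ideal.Quotient.mk_surjective (I := J)
    refine ⟨k, fun i => lift (e i), fun t => ?_⟩
    have ht : Ideal.Quotient.mk J t ∈ Submodule.span R (Set.range e) := he ▸ Submodule.mem_top
    obtain ⟨c, hc⟩ := (Submodule.mem_span_range_iff_exists_fun R).1 ht
    refine ⟨c, ?_⟩
    rw [← hJy, ← Ideal.Quotient.eq, ← hc, map_sum]
    refine Finset.sum_congr rfl fun i _ => ?_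
    rw [map_mul, hlift, Algebra.smul_def]
    rfl
  have hspan' := hspan.span_pow q
  rw [hy] at hspan'
  have hfinal : SpansModulo (algebraMap (PowerSeries R) B) ⊥ := by
    refine SpansModulo.of_series_of_closed (Ideal.span {algebraMap (PowerSeries R) B X})
      (Ideal.mem_span_singleton_self _) (fun v => ⟨mk v, fun M => ?_⟩) (fun x hx => ?_)
      (by rwa [bot_sup_eq])
    · rw [Ideal.span_singleton_pow, Ideal.mem_span_singleton, ← map_pow]
      have h1 : X ^ M ∣ mk v - ∑ n ∈ Finset.range M, C (v n) * X ^ n := by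
        refine X_pow_dvd_iff.2 fun m hm => ?_
        simp [coeff_C_mul, coeff_X_pow, hm]
      have h2 := map_dvd (algebraMap (PowerSeries R) B) h1
      simpa using h2
    · have h1 : ∀ M, X ^ M ∣ N x := fun M => by
        obtain ⟨j, hj, hxj⟩ := hx M
        rw [(Submodule.mem_bot B).1 hj, sub_zero, Ideal.span_singleton_pow,
          Ideal.mem_span_singleton] at hxj
        have h2 := map_dvd N hxj
        rw [map_pow, hNC, ← pow_mul] at h2
        exact (pow_dvd_pow X (Nat.le_mul_of_pos_left M hq)).trans h2
      have h2 : N x = 0 := by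
        ext m
        exact X_pow_dvd_iff.1 (h1 (m + 1)) m m.lt_succ_self
      have h3 := hN x
      rw [h2, map_zero] at h3
      exact (Submodule.mem_bot B).2 (eq_zero_of_pow_eq_zero h3.symm)
  exact RingHom.finite_algebraMap.1 hfinal.finite

end PowerSeries

end FrobeniusRoot

section PowerSeriesClosures

theorem HasFiniteClosures.powerSeries {R : Type u} [CommRing R] [IsDomain R] [IsNoetherianRing R]
    [IsIntegrallyClosed R] (hR : HasFiniteClosures R) : HasFiniteClosures (PowerSeries R) := by
  refine HasFiniteClosures.of_roots fun s e hs => ?_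
  let R₁ := PowerSeries R
  let K := FractionRing R₁
  let Ω := AlgebraicClosure K
  let p := ringExpChar K
  have : ExpChar Ω p := expChar_of_injective_algebraMap (algebraMap K Ω).injective p
  have hRΩ : Function.Injective (algebraMap R₁ Ω) := by
    rw [IsScalarTower.algebraMap_eq R₁ K Ω]
    exact (algebraMap K Ω).injective.comp (IsFractionRing.injective R₁ _)
  have hq : 0 < p ^ e := pow_pos (expChar_pos K p) e
  obtain ⟨y, hy⟩ := IsAlgClosed.exists_pow_nat_eq (algebraMap R₁ Ω PowerSeries.X) hq
  choose! r hr using hs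
  classical
  let P : IntermediateField K Ω := IntermediateField.adjoin K (insert y (s : Set Ω))
  have hPs : ∀ d ∈ s, d ∈ P := fun d hd =>
    IntermediateField.subset_adjoin _ _ (Set.mem_insert_of_mem _ hd)
  have hPy : y ∈ P := IntermediateField.subset_adjoin _ _ (Set.mem_insert _ _)
  have hroot : ∀ d ∈ insert y (s : Set Ω), ∃ r : R₁, algebraMap R₁ Ω r = d ^ p ^ e := by
    rintro d (rfl | hd)
    · exact ⟨_, hy.symm⟩
    · exact ⟨_, hr d hd⟩
  have hP : FiniteDimensional K P := by
    have : Finite (insert y (s : Set Ω) : Set Ω) := (s.finite_toSet.insert y).to_subtype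
    refine IntermediateField.finiteDimensional_adjoin fun d hd => ?_
    obtain ⟨t, ht⟩ := hroot d hd
    refine IsIntegral.of_pow hq ?_
    rw [← ht, IsScalarTower.algebraMap_apply R₁ K Ω]
    exact isIntegral_algebraMap
  have hPpow : ∀ d ∈ P, ∃ k : K, algebraMap K Ω k = d ^ p ^ e := by
    intro d hd
    induction hd using IntermediateField.adjoin_induction with
    | mem d hd =>
      obtain ⟨t, ht⟩ := hroot d hd
      exact ⟨algebraMap R₁ K t, by rw [← ht, ← IsScalarTower.algebraMap_apply]⟩
    | algebraMap k => exact ⟨k ^ p ^ e, map_pow _ _ _⟩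
    | add a b _ _ ha hb =>
      obtain ⟨k, hk⟩ := ha
      obtain ⟨l, hl⟩ := hb
      exact ⟨k + l, by rw [map_add, hk, hl, add_pow_expChar_pow]⟩
    | inv a _ ha =>
      obtain ⟨k, hk⟩ := ha
      exact ⟨k⁻¹, by rw [map_inv₀, hk, inv_pow]⟩
    | mul a b _ _ ha hb =>
      obtain ⟨k, hk⟩ := ha
      obtain ⟨l, hl⟩ := hb
      exact ⟨k * l, by rw [map_mul, hk, hl, mul_pow]⟩
  refine ⟨P, hP, hPs, ?_⟩
  let B := integralClosure R₁ P
  have hnorm : ∀ b : B, ∃ t : R₁, algebraMap R₁ Ω t = ((b : P) : Ω) ^ p ^ e := by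
    intro b
    obtain ⟨k, hk⟩ := hPpow b (b : P).2
    have h1 : IsIntegral R₁ (algebraMap K Ω k) := by
      rw [hk]
      exact (IsIntegral.map (P.val.restrictScalars R₁) b.2).pow _
    have h2 : IsIntegral R₁ k :=
      (isIntegral_algHom_iff (IsScalarTower.toAlgHom R₁ K Ω) (algebraMap K Ω).injective).1 h1
    obtain ⟨t, ht⟩ := IsIntegrallyClosed.isIntegral_iff.1 h2
    exact ⟨t, by rw [IsScalarTower.algebraMap_apply R₁ K Ω, ht, hk]⟩
  choose N₀ hN₀ using hnorm
  let N : B →+* R₁ :=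
    { toFun := N₀
      map_one' := hRΩ (by simp [hN₀])
      map_mul' := fun a b => hRΩ (by simp [hN₀, mul_pow])
      map_zero' := hRΩ (by
        rw [hN₀, map_zero]
        exact zero_pow hq.ne')
      map_add' := fun a b => hRΩ (by simp [hN₀, add_pow_expChar_pow]) }
  have hN : ∀ b : B, algebraMap R₁ B (N b) = b ^ p ^ e := fun b =>
    Subtype.ext (Subtype.ext (hN₀ b))
  have hinj : Function.Injective (algebraMap R₁ B) := fun a b hab => by
    refine hRΩ ?_
    exact congrArg (fun z : B => ((z : P) : Ω)) hab
  let y' : P := ⟨y, hPy⟩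
  have hy' : y' ^ p ^ e = algebraMap R₁ P PowerSeries.X := Subtype.ext hy
  have hyint : IsIntegral R₁ y' := IsIntegral.of_pow hq (by rw [hy']; exact isIntegral_algebraMap)
  have hy0 : y' ≠ 0 := by
    intro h0
    rw [h0, zero_pow hq.ne'] at hy'
    have h1 := congrArg (fun z : P => (z : Ω)) hy'
    refine PowerSeries.X_ne_zero (R := R) (hRΩ ?_)
    rw [map_zero]
    exact h1.symm
  refine PowerSeries.finite_of_pow_mem hR (B := B) hinj N hq hN ⟨y', hyint⟩ (Subtype.ext hy')
    (fun b hb => ?_) (Module.finrank K P) (fun ι _ b hb => ?_)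
  · obtain ⟨g, hg⟩ := hb
    have h1 : (b : P) ^ p ^ e = algebraMap R₁ P (N b) := Subtype.ext (hN₀ b).symm
    have h2 : ((b : P) / y') ^ p ^ e = algebraMap R₁ P g := by
      rw [div_pow, h1, hg, map_mul, ← hy', mul_div_cancel_left₀ _ (pow_ne_zero _ hy0)]
    have h3 : IsIntegral R₁ ((b : P) / y') :=
      IsIntegral.of_pow hq (by rw [h2]; exact isIntegral_algebraMap)
    exact ⟨⟨_, h3⟩, Subtype.ext (mul_div_cancel₀ _ hy0).symm⟩
  · have h1 : LinearIndependent R₁ fun i => (b i : P) :=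
      hb.map' (Subalgebra.val B).toLinearMap (LinearMap.ker_eq_bot.2 Subtype.val_injective)
    exact ((LinearIndependent.iff_fractionRing R₁ K).1 h1).fintype_card_le_finrank

end PowerSeriesClosures

section Normalization

open IsLocalRing

lemma RingHom.IsIntegral.ringKrullDim_le {R A : Type*} [CommRing R] [CommRing A] {f : R →+* A}
    (hf : f.IsIntegral) : ringKrullDim A ≤ ringKrullDim R := by
  algebraize [f]
  exact Order.krullDim_le_of_strictMono (PrimeSpectrum.comap f)
    fun p q (hpq : p.asIdeal < q.asIdeal) => Ideal.IsIntegral.comap_lt_comap (R := R) hpq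

lemma ringKrullDim_powerSeries_le {R : Type*} [CommRing R] [IsLocalRing R] [IsNoetherianRing R] :
    ringKrullDim (PowerSeries R) ≤ ringKrullDim R + 1 := by
  have hX : (({PowerSeries.X} : Finset (PowerSeries R)) : Set (PowerSeries R)) ⊆
      Ring.jacobson (PowerSeries R) := by
    rw [IsLocalRing.ringJacobson_eq_maximalIdeal, Finset.coe_singleton, Set.singleton_subset_iff]
    refine PowerSeries.mem_maximalIdeal_iff.2 ?_
    rw [PowerSeries.constantCoeff_X]
    exact zero_mem _
  refine (ringKrullDim_le_ringKrullDim_quotient_add_card _ hX).trans ?_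
  rw [Finset.card_singleton, Nat.cast_one]
  gcongr
  refine ringKrullDim_le_of_surjective ((Ideal.Quotient.mk _).comp PowerSeries.C) fun x => ?_
  obtain ⟨f, rfl⟩ := Ideal.Quotient.mk_surjective x
  refine ⟨PowerSeries.constantCoeff f, ?_⟩
  rw [RingHom.comp_apply, Ideal.Quotient.eq, Finset.coe_singleton, Ideal.mem_span_singleton,
    PowerSeries.X_dvd_iff]
  simp

lemma exists_finite_of_spansModulo {T : Type u} [CommRing T] [IsLocalRing T] [IsNoetherianRing T]
    [IsAdicComplete (maximalIdeal T) T] (s : Finset T) (hs : ∀ x ∈ s, x ∈ maximalIdeal T)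
    (R : Type u) [CommRing R] [IsDomain R] [IsLocalRing R] [IsNoetherianRing R]
    [IsIntegrallyClosed R] (hR : HasFiniteClosures R) (φ : R →+* T)
    (h : SpansModulo φ (Ideal.span (s : Set T))) :
    ∃ (R' : Type u) (_ : CommRing R') (_ : IsDomain R') (φ' : R' →+* T),
      HasFiniteClosures R' ∧ ringKrullDim R' ≤ ringKrullDim R + s.card ∧ φ'.Finite := by
  classical
  induction s using Finset.induction_on generalizing R with
  | empty => exact ⟨R, _, ‹_›, φ, hR, by simp, (h.mono (by simp)).finite⟩
  | insert z s hz ih =>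
    obtain ⟨ψ, -, -, hψ⟩ := PowerSeries.exists_extension (maximalIdeal T) φ
      (hs z (Finset.mem_insert_self z s))
    have h' : SpansModulo ψ (Ideal.span (s : Set T)) := by
      refine SpansModulo.of_series (φ := φ) (hs z (Finset.mem_insert_self z s))
        (fun v => ⟨PowerSeries.mk v, fun N => ?_⟩) ?_
      · simpa using hψ (PowerSeries.mk v) N
      · rwa [Finset.coe_insert, Ideal.span_insert, sup_comm] at h
    obtain ⟨R', i₁, i₂, φ', hR', hdim, hfin⟩ :=
      ih (fun x hx => hs x (Finset.mem_insert_of_mem hx)) (PowerSeries R) hR.powerSeries ψ h'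
    refine ⟨R', i₁, i₂, φ', hR', hdim.trans ?_, hfin⟩
    rw [Finset.card_insert_of_notMem hz]
    calc ringKrullDim (PowerSeries R) + (s.card : WithBot ℕ∞)
        ≤ ringKrullDim R + 1 + s.card := by gcongr; exact ringKrullDim_powerSeries_le
      _ = ringKrullDim R + ((s.card + 1 : ℕ) : WithBot ℕ∞) := by
        push_cast
        rw [add_assoc, add_comm (1 : WithBot ℕ∞)]

/-- Lifts of a system of parameters modulo `z`. -/
lemma exists_finset_pow_maximalIdeal_le {T : Type*} [CommRing T] [IsLocalRing T]
    [IsNoetherianRing T] {z : T} (hz : z ∈ maximalIdeal T) :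
    ∃ (s : Finset T) (n : ℕ), (∀ x ∈ s, x ∈ maximalIdeal T) ∧
      maximalIdeal T ^ n ≤ Ideal.span (s : Set T) ⊔ Ideal.span {z} ∧
      (s.card : WithBot ℕ∞) ≤ ringKrullDim (T ⧸ Ideal.span {z}) := by
  classical
  let I : Ideal T := Ideal.span {z}
  have hI : I ≤ maximalIdeal T := (Ideal.span_singleton_le_iff_mem _).2 hz
  have : Nontrivial (T ⧸ I) :=
    Ideal.Quotient.nontrivial_iff.2 (ne_top_of_le_ne_top (maximalIdeal.isMaximal T).ne_top hI)
  have : IsLocalRing (T ⧸ I) :=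
    IsLocalRing.of_surjective' (Ideal.Quotient.mk I) Ideal.Quotient.mk_surjective
  have hmap : (maximalIdeal T).map (Ideal.Quotient.mk I) = maximalIdeal (T ⧸ I) :=
    IsLocalRing.maximalIdeal_map_of_surjective _ Ideal.Quotient.mk_surjective
  obtain ⟨s', hmin, hcard⟩ :=
    (maximalIdeal (T ⧸ I)).exists_finset_card_eq_height_of_isNoetherianRing
  choose lift hlift using Ideal.Quotient.mk_surjective (I := I)
  have hrad : maximalIdeal (T ⧸ I) ≤ (Ideal.span (s' : Set (T ⧸ I))).radical := by
    rw [Ideal.radical_eq_sInf]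
    exact le_sInf fun J hJ => hmin.2 ⟨hJ.2, hJ.1⟩ (le_maximalIdeal hJ.2.ne_top)
  obtain ⟨n, hn⟩ := Ideal.exists_pow_le_of_le_radical_of_fg hrad (IsNoetherian.noetherian _)
  refine ⟨s'.image lift, n, fun x hx => ?_, fun x hx => ?_, ?_⟩
  · obtain ⟨y, hy, rfl⟩ := Finset.mem_image.1 hx
    have h1 : y ∈ maximalIdeal (T ⧸ I) := hmin.1.2 (Ideal.subset_span hy)
    rw [mem_maximalIdeal, mem_nonunits_iff] at h1 ⊢
    exact fun h2 => h1 (hlift y ▸ h2.map (Ideal.Quotient.mk I))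
  · have h1 : Ideal.Quotient.mk I x ∈ maximalIdeal (T ⧸ I) ^ n := by
      rw [← hmap, ← Ideal.map_pow]
      exact Ideal.mem_map_of_mem _ hx
    have h2 : (Ideal.span ((s'.image lift : Finset T) : Set T)).map (Ideal.Quotient.mk I) =
        Ideal.span (s' : Set (T ⧸ I)) := by
      rw [Ideal.map_span, Finset.coe_image, Set.image_image]
      simp [hlift]
    have h3 := hn h1
    rw [← h2, ← Ideal.mem_comap,
      Ideal.comap_map_of_surjective _ Ideal.Quotient.mk_surjective, ← RingHom.ker_eq_comap_bot,
      Ideal.mk_ker] at h3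
    exact h3
  · rw [← IsLocalRing.maximalIdeal_height_eq_ringKrullDim, ← hcard]
    exact_mod_cast Finset.card_image_le

/-- A complete local Noetherian domain has a module-finite integral closure. -/
theorem finite_integralClosure_of_isAdicComplete (T : Type u) [CommRing T] [IsDomain T]
    [IsLocalRing T] [IsNoetherianRing T] [IsAdicComplete (maximalIdeal T) T] :
    Module.Finite T (integralClosure T (FractionRing T)) := by
  obtain ⟨V, ϖ, hV⟩ := exists_isCoefficientSubring T
  obtain ⟨s, n, hs, hle, hcard⟩ := exists_finset_pow_maximalIdeal_le hV.mem_maximalIdeal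
  have := hV.isLocalRing
  have := hV.isPrincipalIdealRing
  have hdim : ringKrullDim V + s.card ≤ ringKrullDim T := by
    rcases eq_or_ne ϖ 0 with h0 | h0
    · rw [ringKrullDim_eq_zero_of_isField (hV.isField h0), zero_add]
      exact hcard.trans (ringKrullDim_le_of_surjective _ Ideal.Quotient.mk_surjective)
    · have := hV.isDiscreteValuationRing h0
      rw [IsDiscreteValuationRing.ringKrullDim_eq_one, add_comm]
      refine le_trans ?_ (ringKrullDim_quotient_succ_le_of_nonZeroDivisor
        (mem_nonZeroDivisors_of_ne_zero h0))
      gcongr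
  have hspan : SpansModulo V.subtype (Ideal.span (s : Set T)) := by
    refine SpansModulo.of_series (φ := V.subtype) hV.mem_maximalIdeal (fun v => ?_)
      ((SpansModulo.maximalIdeal_pow (fun t => ?_) n).mono hle)
    · obtain ⟨w, hw, h⟩ := hV.exists_series (fun n => v n) fun n => (v n).2
      exact ⟨⟨w, hw⟩, h⟩
    · obtain ⟨v, hv, h⟩ := hV.exists_sub_mem t
      exact ⟨⟨v, hv⟩, h⟩
  obtain ⟨R, _, _, φ, hR, hRdim, hfin⟩ :=
    exists_finite_of_spansModulo s hs V hV.hasFiniteClosures V.subtype hspan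
  have hinj : Function.Injective φ := by
    rw [injective_iff_map_eq_zero]
    by_contra! hker
    obtain ⟨r, hr, hr0⟩ := hker
    have h1 : ringKrullDim φ.range + 1 ≤ ringKrullDim R :=
      ringKrullDim_succ_le_of_surjective φ.rangeRestrict φ.rangeRestrict_surjective
        (mem_nonZeroDivisors_of_ne_zero hr0) (Subtype.ext hr)
    have h2 : φ.range.subtype.IsIntegral := fun t => by
      obtain ⟨p, hp, hpt⟩ := hfin.to_isIntegral t
      refine ⟨p.map φ.rangeRestrict, hp.map _, ?_⟩
      rw [eval₂_map]
      exact hpt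
    have h3 : ringKrullDim T + 1 ≤ ringKrullDim T :=
      ((add_le_add_left h2.ringKrullDim_le 1).trans h1).trans (hRdim.trans hdim)
    obtain ⟨d, hd⟩ : ∃ d : ℕ, ringKrullDim T = d := by
      have hbot : ringKrullDim T ≠ ⊥ := ringKrullDim_ne_bot
      have htop : ringKrullDim T ≠ ⊤ := ringKrullDim_ne_top
      lift ringKrullDim T to ℕ∞ using hbot with d
      lift d to ℕ using fun h => htop (by rw [h]; rfl)
      exact ⟨d, rfl⟩
    rw [hd] at h3
    norm_cast at h3
    omega
  algebraize [φ]
  exact hR.finite_integralClosure T hinj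

end Normalization

/-- **Theorem.** Let `S` be a domain which is a complete local Noetherian ring, or finitely
generated over a field or `ℤ`, or more generally finitely generated over a Noetherian
integrally closed domain `R` such that every finitely generated `R`-algebra has module-finite
integral closure. Let `a` be a filtration of nonzero ideals and `b` a graded family which is
`bb`-equivalent for some ideal `bb`. Then
`ρ̂(a, b̄) = ρ^lim(a, b̄) = ρ̂(a, b) = ρ^lim(a, b)`. -/
theorem statement17 {S : Type u} [CommRing S] [IsDomain S] [IsNoetherianRing S]
    (hS : AdmissibleDomain S)
    (a b : ℕ → Ideal S) (ha : IdealFiltration a) (hanz : ∀ i : ℕ, 1 ≤ i → a i ≠ ⊥)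
    (hb : GradedFamily b) (bb : Ideal S) (heq : BEquivalent bb b) :
    asympResurgence a (fun i => intClosure (b i)) =
        rhoLim a (fun i => intClosure (b i)) ∧
      rhoLim a (fun i => intClosure (b i)) = asympResurgence a b ∧
      asympResurgence a b = rhoLim a b := by
  have hbb : LinearlyBoundedClosure bb := by
    rcases hS with ⟨-, m, hmax, huniq, hcomplete⟩ | ⟨⟨h⟩⟩ | h | ⟨⟨h⟩⟩
    · have : IsLocalRing S := IsLocalRing.of_unique_max_ideal ⟨m, hmax, huniq⟩
      have hm : IsLocalRing.maximalIdeal S = m := huniq _ (IsLocalRing.maximalIdeal.isMaximal S)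
      have : IsAdicComplete (IsLocalRing.maximalIdeal S) S := hm ▸ hcomplete
      exact LinearlyBoundedClosure.of_forall_complete_finite bb
        finite_integralClosure_of_isAdicComplete
    · exact LinearlyBoundedClosure.of_fieldBase h bb
    · exact LinearlyBoundedClosure.of_finiteType_int h bb
    · exact LinearlyBoundedClosure.of_nagataBase h bb
  exact asympResurgence_eq_rhoLim ha (hanz 1 le_rfl) hbb heq
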